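/- arXiv:1207.0237 — 3 statements merged into one kernel-verified Lean document; each statement's English description precedes it below -/
import Mathlib

section
/- Let G be a tournament and H a prime subtournament of G with |V(H)| ≥ 3. Then: (i) every vertex of V(G)∖V(H) lies in exactly one of the sets Ext(H), Z(H), and V_x(H) for x ∈ V(H); (ii) if u, v ∈ Ext(H) are distinct and H+{u,v} is decomposable, then {u,v} is a homogeneous set of H+{u,v}; (iii) if u ∈ Z(H) and v ∈ (V(G)∖V(H))∖Z(H) and H+{u,v} is decomposable, then V(H)∪{v} is a homogeneous set of H+{u,v}; (iv) if u ∈ V_x(H) for some x ∈ V(H) and v ∈ (V(G)∖V(H))∖V_x(H) and H+{u,v} is decomposable, then {u,x} is a homogeneous set of H+{u,v}. -/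
/-- A tournament on a vertex type `V`: for any two distinct vertices exactly one of the
two possible directed edges is present. -/
structure Tournament (V : Type) where
  rel : V → V → Prop
  asymm : ∀ u v, rel u v → ¬ rel v u
  total : ∀ u v, u ≠ v → rel u v ∨ rel v u

namespace Tournament

variable {V : Type}

/-- `X` is a homogeneous set of the subtournament of `T` induced on `S`. -/
def HomogOn (T : Tournament V) (S X : Set V) : Prop :=
  X ⊆ S ∧ ∀ v ∈ S \ X, (∀ x ∈ X, T.rel v x) ∨ (∀ x ∈ X, T.rel x v)

/-- The subtournament of `T` induced on `S` is prime: it is a (nonempty) tournament all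
of whose homogeneous sets are trivial. -/
def PrimeOn (T : Tournament V) (S : Set V) : Prop :=
  S.Nonempty ∧ ∀ X : Set V, T.HomogOn S X → X.ncard ≤ 1 ∨ X = S

/-- The subtournament of `T` induced on `S` is isomorphic to the tournament on `Fin n`
with edge relation `r`. -/
def IsoOnFin (T : Tournament V) (S : Set V) {n : ℕ} (r : Fin n → Fin n → Prop) : Prop :=
  ∃ f : Fin n → V, Function.Injective f ∧ Set.range f = S ∧
    ∀ i j : Fin n, r i j ↔ T.rel (f i) (f j)

/-- `T` has a subtournament isomorphic to the tournament on `Fin n` with edge relation `r`. -/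
def HasSub (T : Tournament V) {n : ℕ} (r : Fin n → Fin n → Prop) : Prop :=
  ∃ f : Fin n → V, Function.Injective f ∧ ∀ i j : Fin n, r i j ↔ T.rel (f i) (f j)

/-- The subtournament of `T` induced on `S` has a subtournament isomorphic to the
tournament on `Fin n` with edge relation `r`. -/
def HasSubIn (T : Tournament V) (S : Set V) {n : ℕ} (r : Fin n → Fin n → Prop) : Prop :=
  ∃ f : Fin n → V, Function.Injective f ∧ (∀ i, f i ∈ S) ∧
    ∀ i j : Fin n, r i j ↔ T.rel (f i) (f j)

/-- `v ∈ Ext(H)`: `v` is outside `H` and `H + v` is prime. -/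
def mem_Ext (T : Tournament V) (H : Set V) (v : V) : Prop :=
  v ∉ H ∧ T.PrimeOn (insert v H)

/-- `v ∈ Z(H)`: `v` is outside `H` and `H` is a homogeneous set of `H + v`. -/
def mem_Z (T : Tournament V) (H : Set V) (v : V) : Prop :=
  v ∉ H ∧ T.HomogOn (insert v H) H

/-- `v ∈ V_x(H)`: `v` is outside `H` and `{v, x}` is a homogeneous set of `H + v`. -/
def mem_Vx (T : Tournament V) (H : Set V) (x v : V) : Prop :=
  v ∉ H ∧ T.HomogOn (insert v H) {v, x}

/-- `C` is (the vertex set of) a cyclic triangle of `T`. -/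
def CycTri (T : Tournament V) (C : Set V) : Prop :=
  ∃ a b c : V, C = {a, b, c} ∧ T.rel a b ∧ T.rel b c ∧ T.rel c a

/-- The cyclic triangles `C` and `C'` are triangle-connected: there is a sequence of
cyclic triangles from `C` to `C'` in which consecutive triangles share exactly two
vertices. -/
def TriConn (T : Tournament V) (C C' : Set V) : Prop :=
  ∃ m : ℕ, ∃ f : Fin (m + 1) → Set V,
    f 0 = C ∧ f (Fin.last m) = C' ∧ (∀ i, T.CycTri (f i)) ∧
    ∀ i : Fin m, ((f i.castSucc) ∩ (f i.succ)).ncard = 2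

/-- `T` is strongly connected. -/
def StronglyConnected (T : Tournament V) : Prop :=
  ∀ u v : V, Relation.ReflTransGen T.rel u v

/-- The subtournament of `T` induced on `S` is a transitive tournament. -/
def TransOn (T : Tournament V) (S : Set V) : Prop :=
  ∃ m : ℕ, ∃ f : Fin m → V, Function.Injective f ∧ Set.range f = S ∧
    ∀ i j : Fin m, i < j → T.rel (f i) (f j)

end Tournament

/-- The tournament `T_n` (`n = 2k+1` odd) on `Fin n`: `i → j` iff `j - i mod n ∈ {1, …, k}`. -/
def TTrel (n : ℕ) (i j : Fin n) : Prop :=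
  1 ≤ (j.val + n - i.val) % n ∧ (j.val + n - i.val) % n ≤ n / 2

/-- The tournament `U_n`: obtained from `T_n` by reversing all edges with both ends among
the first `k` vertices. -/
def UUrel (n : ℕ) (i j : Fin n) : Prop :=
  if i.val < n / 2 ∧ j.val < n / 2 then TTrel n j i else TTrel n i j

/-- The tournament `W_n` on `Fin n` (vertex `n-1` plays the role of `w_n`). -/
def WWrel (n : ℕ) (i j : Fin n) : Prop :=
  (i.val < j.val ∧ j.val < n - 1) ∨ (j.val = n - 1 ∧ i.val < n - 1 ∧ i.val % 2 = 1) ∨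
    (i.val = n - 1 ∧ j.val < n - 1 ∧ j.val % 2 = 0)

/-- The tournament `P_n` on `Fin n`: `i → j` iff `j - i ≥ 2` or `i = j + 1`. -/
def PPrel (n : ℕ) (i j : Fin n) : Prop := i.val + 2 ≤ j.val ∨ i.val = j.val + 1

/-- The tournament `D_4`: vertex `0` beats the cyclic triangle `{1, 2, 3}`. -/
def DDrel (i j : Fin 4) : Prop :=
  (i = 0 ∧ j ≠ 0) ∨ (i = 1 ∧ j = 2) ∨ (i = 2 ∧ j = 3) ∨ (i = 3 ∧ j = 1)

/-- The tournament `J_n` on `Fin n`: the identity ordering has exactly one backedge,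
from the last vertex to the first. -/
def JJrel (n : ℕ) (i j : Fin n) : Prop :=
  (i.val < j.val ∧ ¬(i.val = 0 ∧ j.val = n - 1)) ∨ (i.val = n - 1 ∧ j.val = 0)

/-- The tournament `K_n` on `Fin n`: the identity ordering has exactly one backedge,
from the last vertex to the second. -/
def KKrel (n : ℕ) (i j : Fin n) : Prop :=
  (i.val < j.val ∧ ¬(i.val = 1 ∧ j.val = n - 1)) ∨ (i.val = n - 1 ∧ j.val = 1)

/-- The tournament `K_n^*` on `Fin n`: the identity ordering has exactly one backedge,
from the second-to-last vertex to the first. -/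
def KKsrel (n : ℕ) (i j : Fin n) : Prop :=
  (i.val < j.val ∧ ¬(i.val = 0 ∧ j.val = n - 2)) ∨ (i.val = n - 2 ∧ j.val = 0)

/-- `(j, i)` (0-indexed, `i < j`) is one of the backedges of the defining ordering of `Q_n`. -/
def Qback (n i j : ℕ) : Prop :=
  (j = n - 2 ∧ i = 0) ∨ (j = n - 1 ∧ i = n - 3) ∨ (j = i + 1 ∧ j ≤ n - 3)

/-- The tournament `Q_n` on `Fin n`. -/
def QQrel (n : ℕ) (i j : Fin n) : Prop :=
  (i.val < j.val ∧ ¬ Qback n i.val j.val) ∨ (j.val < i.val ∧ Qback n j.val i.val)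

/-- `e` is a matching ordering of the tournament with edge relation `r` on `V`:
`e` lists all vertices and every vertex is the head or tail of at most one backedge. -/
def MatchingOrd {V : Type} (r : V → V → Prop) {m : ℕ} (e : Fin m → V) : Prop :=
  Function.Bijective e ∧
    ∀ i : Fin m, {j : Fin m | (i < j ∧ r (e j) (e i)) ∨ (j < i ∧ r (e i) (e j))}.Subsingleton

/-- `e` is a matching ordering of the subtournament induced on `S`. -/
def MatchingOrdOn {V : Type} (r : V → V → Prop) (S : Set V) {m : ℕ} (e : Fin m → V) : Prop :=
  Set.BijOn e Set.univ S ∧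
    ∀ i : Fin m, {j : Fin m | (i < j ∧ r (e j) (e i)) ∨ (j < i ∧ r (e i) (e j))}.Subsingleton

/-- The subtournament induced on `S` is a matching tournament. -/
def IsMatchingOn {V : Type} (r : V → V → Prop) (S : Set V) : Prop :=
  ∃ m : ℕ, ∃ e : Fin m → V, MatchingOrdOn r S e

/-- The permutation `σ_X` of the interval of integers `X = {b, …, a}` (identity off `X`):
the cycle `(b b+2 … a-2 a a-1 a-3 … b+1)` when `|X|` is odd and
`(b b+2 … a-1 a a-2 … b+1)` when `|X|` is even. -/
def sigmaX (b a x : ℕ) : ℕ :=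
  if x < b ∨ a < x then x
  else if a = b then x
  else if (x - b) % 2 = 0 then
    (if x + 2 ≤ a then x + 2 else if x + 1 ≤ a then x + 1 else x - 1)
  else (if b + 3 ≤ x then x - 2 else b)

/-- The permutation `τ_X = (b b+2)(b+1 b+3)` of `X = {b, b+1, b+2, b+3}`. -/
def tauX (b x : ℕ) : ℕ :=
  if x = b then b + 2 else if x = b + 2 then b
  else if x = b + 1 then b + 3 else if x = b + 3 then b + 1 else x

/-- The permutation `π_1` of the interval `{b, …, a}`: product of the transpositions
swapping the 1st and 2nd, 3rd and 4th, … elements of the interval. -/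
def pi1N (b a x : ℕ) : ℕ :=
  if x < b ∨ a < x then x
  else if (x - b) % 2 = 0 then (if x + 1 ≤ a then x + 1 else x)
  else x - 1

/-- The permutation `π_2` of the interval `{b, …, a}`: product of the transpositions
swapping the 2nd and 3rd, 4th and 5th, … elements of the interval. -/
def pi2N (b a x : ℕ) : ℕ :=
  if x < b ∨ a < x then x
  else if x = b then x
  else if (x - b) % 2 = 1 then (if x + 1 ≤ a then x + 1 else x)
  else x - 1

/-- The segment of the ordering `e` on positions `b, …, a` induces a transitive tournament,
with ordering given (relative to the standard ordering `f`) by the permutation `p`. -/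
def SegTrans {V : Type} (T : Tournament V) {n : ℕ} (e : Fin n → V) (b a : ℕ) (p : ℕ → ℕ) : Prop :=
  ∃ f : ℕ → V, (∀ x y : ℕ, b ≤ x → x < y → y ≤ a → T.rel (f x) (f y)) ∧
    ∀ i : Fin n, b ≤ i.val → i.val ≤ a → e i = f (p i.val)

/-- The segment of the ordering `e` on positions `b, …, a` induces a tournament isomorphic
to `P_m` (where `m = a - b + 1`), with ordering given (relative to the defining ordering
`f` of `P_m`) by the permutation `p`. -/
def SegP {V : Type} (T : Tournament V) {n : ℕ} (e : Fin n → V) (b a : ℕ) (p : ℕ → ℕ) : Prop :=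
  ∃ f : ℕ → V,
    (∀ x y : ℕ, b ≤ x → x ≤ a → b ≤ y → y ≤ a →
      (T.rel (f x) (f y) ↔ (x + 2 ≤ y ∨ x = y + 1))) ∧
    ∀ i : Fin n, b ≤ i.val → i.val ≤ a → e i = f (p i.val)

namespace Tournament

variable {V : Type}

theorem hom_iff (T : Tournament V) (S X : Set V) : T.HomogOn S X ↔
    (X ⊆ S ∧ ∀ w ∈ S, w ∉ X → ∀ a ∈ X, ∀ b ∈ X, T.rel w a → T.rel w b) := by
  constructor
  · rintro ⟨h1, h2⟩
    refine ⟨h1, fun w hw hx a ha b hb hab => ?_⟩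
    rcases h2 w ⟨hw, hx⟩ with h | h
    · exact h b hb
    · exact absurd hab (T.asymm _ _ (h a ha))
  · rintro ⟨h1, h2⟩
    refine ⟨h1, fun w hw => ?_⟩
    by_cases h : ∃ a ∈ X, T.rel w a
    · obtain ⟨a, ha, hwa⟩ := h
      exact Or.inl fun b hb => h2 w hw.1 hw.2 a ha b hb hwa
    · refine Or.inr fun b hb => ?_
      have hne : w ≠ b := fun e => hw.2 (e ▸ hb)
      rcases T.total w b hne with h' | h'
      · exact absurd ⟨b, hb, h'⟩ h
      · exact h'

theorem ncard_le_one_iff' [Fintype V] (X : Set V) :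
    X.ncard ≤ 1 ↔ ∀ a ∈ X, ∀ b ∈ X, a = b := by
  rw [Set.ncard_le_one (Set.toFinite X)]

/-- Trace of a homogeneous set on a prime subset. -/
theorem trace [Fintype V] (T : Tournament V) {H S X : Set V} (hH : T.PrimeOn H)
    (hS : H ⊆ S) (hX : T.HomogOn S X) :
    (∀ a ∈ X, a ∈ H → ∀ b ∈ X, b ∈ H → a = b) ∨ H ⊆ X := by
  rw [hom_iff] at hX
  have h : T.HomogOn H (X ∩ H) := by
    rw [hom_iff]
    refine ⟨Set.inter_subset_right, fun w hw hwx a ha b hb => ?_⟩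
    exact hX.2 w (hS hw) (fun h => hwx ⟨h, hw⟩) a ha.1 b hb.1
  rcases hH.2 _ h with h | h
  · left
    rw [ncard_le_one_iff'] at h
    exact fun a ha ha' b hb hb' => h a ⟨ha, ha'⟩ b ⟨hb, hb'⟩
  · right
    rw [← h]
    exact Set.inter_subset_left

theorem notPrime [Fintype V] (T : Tournament V) {S : Set V} (hne : S.Nonempty) 
    (h : ¬ T.PrimeOn S) :
    ∃ X, T.HomogOn S X ∧ (∃ a ∈ X, ∃ b ∈ X, a ≠ b) ∧ ∃ c ∈ S, c ∉ X := by
  unfold PrimeOn at h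
  push Not at h
  obtain ⟨X, hX, h1, h2⟩ := h hne
  refine ⟨X, hX, ?_, ?_⟩
  · by_contra hc
    push Not at hc
    exact absurd ((ncard_le_one_iff' X).2 hc) (by omega)
  · by_contra hc
    push Not at hc
    exact h2 (Set.Subset.antisymm hX.1 hc)

theorem prime_use [Fintype V] (T : Tournament V) {S X : Set V} (h : T.PrimeOn S)
    (hX : T.HomogOn S X) {a b c : V} (ha : a ∈ X) (hb : b ∈ X) (hab : a ≠ b) 
    (hc : c ∈ S) (hcX : c ∉ X) : False := by
  rcases h.2 X hX with h | h
  · exact hab ((ncard_le_one_iff' X).1 h a ha b hb)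
  · exact hcX (h ▸ hc)

theorem Z_iff (T : Tournament V) {H : Set V} {v : V} (hv : v ∉ H) :
    T.mem_Z H v ↔ ∀ a ∈ H, ∀ b ∈ H, T.rel v a → T.rel v b := by
  unfold mem_Z
  rw [hom_iff]
  grind

theorem Vx_iff (T : Tournament V) {H : Set V} {v x : V} (hv : v ∉ H) (hx : x ∈ H) :
    T.mem_Vx H x v ↔ ∀ y ∈ H, y ≠ x → (T.rel y v ↔ T.rel y x) := by
  unfold mem_Vx
  rw [hom_iff]
  grind

theorem flip (T : Tournament V) {a b : V} (h : a ≠ b) : T.rel a b ↔ ¬ T.rel b a :=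
  ⟨T.asymm a b, fun h' => (T.total a b h).resolve_right h'⟩

theorem exists_two [Fintype V] {H : Set V} (h3 : 3 ≤ H.ncard) (x : V) :
    ∃ a ∈ H, ∃ b ∈ H, a ≠ b ∧ a ≠ x ∧ b ≠ x := by
  have h1 := Set.pred_ncard_le_ncard_diff_singleton H x
  have h2 : 1 < (H \ {x}).ncard := by omega
  obtain ⟨a, ha, b, hb, hab⟩ := (Set.one_lt_ncard (Set.toFinite _)).1 h2
  exact ⟨a, ha.1, b, hb.1, hab, ha.2, hb.2⟩

theorem Z_Vx [Fintype V] (T : Tournament V) {H : Set V} (hH : T.PrimeOn H)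
    (h3 : 3 ≤ H.ncard) {v x : V} (hv : v ∉ H) (hx : x ∈ H)
    (hz : T.mem_Z H v) (hvx : T.mem_Vx H x v) : False := by
  rw [Z_iff T hv] at hz
  rw [Vx_iff T hv hx] at hvx
  obtain ⟨a, ha, b, hb, hab, hax, hbx⟩ := exists_two h3 x
  refine prime_use T hH (X := H \ {x}) ?_ ⟨ha, hax⟩ ⟨hb, hbx⟩ hab hx (by simp)
  rw [hom_iff]
  refine ⟨Set.diff_subset, fun w hw hwx p hp q hq hr => ?_⟩
  have : w = x := by by_contra h; exact hwx ⟨hw, h⟩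
  subst this
  have hpv : p ≠ v := fun e => hv (e ▸ hp.1)
  have hqv : q ≠ v := fun e => hv (e ▸ hq.1)
  have e1 := hvx p hp.1 hp.2
  have e2 := hvx q hq.1 hq.2
  have e3 := hz p hp.1 q hq.1
  have f1 := T.flip hpv
  have f2 := T.flip hqv
  have f3 := T.flip (show p ≠ w from hp.2)
  have f4 := T.flip (show q ≠ w from hq.2)
  tauto

theorem Vx_unique [Fintype V] (T : Tournament V) {H : Set V} (hH : T.PrimeOn H)
    (h3 : 3 ≤ H.ncard) {v x y : V} (hv : v ∉ H) (hx : x ∈ H) (hy : y ∈ H)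
    (hvx : T.mem_Vx H x v) (hvy : T.mem_Vx H y v) : x = y := by
  rw [Vx_iff T hv hx] at hvx
  rw [Vx_iff T hv hy] at hvy
  by_contra hxy
  obtain ⟨a, ha, b, hb, hab, hax, hbx⟩ := exists_two h3 x
  have : ∃ c ∈ H, c ∉ ({x, y} : Set V) := by grind
  obtain ⟨c, hc, hc'⟩ := this
  refine prime_use T hH (X := {x, y}) ?_ (a := x) (b := y) (by simp) (by simp) hxy hc hc'
  rw [hom_iff]
  grind

theorem one_ext [Fintype V] (T : Tournament V) {H : Set V} (hH : T.PrimeOn H)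
    {v : V} (hv : v ∉ H) (he : ¬ T.mem_Ext H v) :
    T.mem_Z H v ∨ ∃ x ∈ H, T.mem_Vx H x v := by
  have hnp : ¬ T.PrimeOn (insert v H) := fun h => he ⟨hv, h⟩
  obtain ⟨X, hX, ⟨a, ha, b, hb, hab⟩, c, hc, hcX⟩ := T.notPrime (by simp) hnp
  have ht := T.trace hH (Set.subset_insert v H) hX
  rw [hom_iff] at hX
  obtain ⟨hs, hX⟩ := hX
  rcases ht with ht | ht
  · right
    have : v ∈ X ∧ ∃ x ∈ H, x ∈ X := by grind
    obtain ⟨hvX, x, hx, hxX⟩ := this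
    refine ⟨x, hx, (Vx_iff T hv hx).2 ?_⟩
    grind
  · left
    rw [Z_iff T hv]
    grind

theorem Ext_Z [Fintype V] (T : Tournament V) {H : Set V} 
    (h3 : 3 ≤ H.ncard) {v : V} (he : T.mem_Ext H v) (hz : T.mem_Z H v) : False := by
  obtain ⟨a, ha, b, hb, hab, -, -⟩ := exists_two h3 v
  exact prime_use T he.2 hz.2 ha hb hab (Set.mem_insert v H) hz.1

theorem Ext_Vx [Fintype V] (T : Tournament V) {H : Set V} 
    (h3 : 3 ≤ H.ncard) {v x : V} (hx : x ∈ H) (he : T.mem_Ext H v)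
    (hz : T.mem_Vx H x v) : False := by
  obtain ⟨a, ha, b, hb, hab, hax, -⟩ := exists_two h3 x
  have hv := hz.1
  refine prime_use T he.2 hz.2 (a := v) (b := x) (c := a) ?_ ?_ ?_ ?_ ?_ <;> grind

end Tournament

open Tournament

set_option maxHeartbeats 4000000

/-- Ehrenfeucht–Rozenberg: for a prime subtournament `H` of `G` with at least 3 vertices,
(i) each outside vertex lies in exactly one of `Ext(H)`, `Z(H)`, `V_x(H)` (`x ∈ V(H)`);
(ii)–(iv) the homogeneous-set conclusions for decomposable two-vertex extensions. -/
theorem stmt0 {V : Type} [Fintype V] (T : Tournament V) (H : Set V)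
    (hH : T.PrimeOn H) (h3 : 3 ≤ H.ncard) :
    (∀ v ∉ H,
      (T.mem_Ext H v ∧ ¬ T.mem_Z H v ∧ ∀ x ∈ H, ¬ T.mem_Vx H x v) ∨
      (¬ T.mem_Ext H v ∧ T.mem_Z H v ∧ ∀ x ∈ H, ¬ T.mem_Vx H x v) ∨
      (¬ T.mem_Ext H v ∧ ¬ T.mem_Z H v ∧ ∃! x, x ∈ H ∧ T.mem_Vx H x v)) ∧
    (∀ u v : V, T.mem_Ext H u → T.mem_Ext H v → u ≠ v →
      ¬ T.PrimeOn (insert u (insert v H)) →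
      T.HomogOn (insert u (insert v H)) {u, v}) ∧
    (∀ u v : V, T.mem_Z H u → v ∉ H → ¬ T.mem_Z H v →
      ¬ T.PrimeOn (insert u (insert v H)) →
      T.HomogOn (insert u (insert v H)) (insert v H)) ∧
    (∀ x u v : V, x ∈ H → T.mem_Vx H x u → v ∉ H → ¬ T.mem_Vx H x v →
      ¬ T.PrimeOn (insert u (insert v H)) →
      T.HomogOn (insert u (insert v H)) {u, x}) := by
  refine ⟨fun v hv => ?_, fun u v hu hv huv hnp => ?_, fun u v hu hv hvz hnp => ?_,
    fun x u v hx hu hv hvx hnp => ?_⟩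
  · by_cases he : T.mem_Ext H v
    · exact Or.inl ⟨he, fun h => Ext_Z T h3 he h, fun x hx h => Ext_Vx T h3 hx he h⟩
    · rcases one_ext T hH hv he with h | ⟨x, hx, h⟩
      · exact Or.inr (Or.inl ⟨he, h, fun x hx h' => Z_Vx T hH h3 hv hx h h'⟩)
      · refine Or.inr (Or.inr ⟨he, fun h' => Z_Vx T hH h3 hv hx h' h, x, ⟨hx, h⟩, ?_⟩)
        rintro y ⟨hy, h'⟩
        exact Vx_unique T hH h3 hv hy hx h' h
  · obtain ⟨X, hX, ⟨a, ha, b, hb, hab⟩, c, hc, hcX⟩ := T.notPrime (by simp) hnp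
    have t1 := T.trace hu.2 (S := insert u (insert v H)) (by grind) hX
    have t2 := T.trace hv.2 (S := insert u (insert v H)) (by grind) hX
    obtain ⟨p, hp, q, hq, hpq, -, -⟩ := exists_two h3 u
    have hXe : X = {u, v} := by
      have hs := hX.1
      rcases t1 with t1 | t1 <;> rcases t2 with t2 | t2
      · ext z
        grind
      · exact absurd (t1 p (t2 (by simp [hp])) (by simp [hp]) q (t2 (by simp [hq]))
          (by simp [hq])) hpq
      · exact absurd (t2 p (t1 (by simp [hp])) (by simp [hp]) q (t1 (by simp [hq]))
          (by simp [hq])) hpq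
      · grind
    exact hXe ▸ hX
  · obtain ⟨X, hX, ⟨a, ha, b, hb, hab⟩, c, hc, hcX⟩ := T.notPrime (by simp) hnp
    have t := T.trace hH (S := insert u (insert v H)) (by grind) hX
    have huH := hu.1
    have huV : ∀ x ∈ H, ¬ T.mem_Vx H x u := fun x hx h => Z_Vx T hH h3 huH hx hu h
    rw [hom_iff] at hX ⊢
    obtain ⟨hs, hX⟩ := hX
    rw [Z_iff T huH] at hu
    rw [Z_iff T hv] at hvz
    refine ⟨by grind, ?_⟩
    rcases t with t | t
    · by_cases huX : u ∈ X
      · exfalso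
        by_cases hy : ∃ y ∈ H, y ∈ X
        · obtain ⟨y, hy, hyX⟩ := hy
          apply huV y hy
          rw [Vx_iff T huH hy]
          grind
        · have hvX : v ∈ X := by grind
          apply hvz
          intro p hp q hq
          have e1 := hX p (by grind) (by grind) u huX v hvX
          have e2 := hX p (by grind) (by grind) v hvX u huX
          have e3 := hX q (by grind) (by grind) u huX v hvX
          have e4 := hX q (by grind) (by grind) v hvX u huX
          have f1 := T.flip (show p ≠ u by grind)
          have f2 := T.flip (show q ≠ u by grind)
          have f3 := T.flip (show p ≠ v by grind)
          have f4 := T.flip (show q ≠ v by grind)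
          have f5 := hu p hp q hq
          tauto
      · have : v ∈ X ∧ ∃ y ∈ H, y ∈ X := by grind
        obtain ⟨hvX, y, hy, hyX⟩ := this
        have e1 := hX u (by grind) huX v hvX y hyX
        have e2 := hX u (by grind) huX y hyX v hvX
        grind
    · by_cases hvX : v ∈ X
      · grind
      · grind
  · obtain ⟨X, hX, ⟨a, ha, b, hb, hab⟩, c, hc, hcX⟩ := T.notPrime (by simp) hnp
    have t := T.trace hH (S := insert u (insert v H)) (by grind) hX
    have huH := hu.1
    have huZ : ¬ T.mem_Z H u := fun h => Z_Vx T hH h3 huH hx h hu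
    have huy : ∀ y ∈ H, T.mem_Vx H y u → x = y :=
      fun y hy h => Vx_unique T hH h3 huH hx hy hu h
    rw [hom_iff] at hX ⊢
    obtain ⟨hs, hX⟩ := hX
    rw [Vx_iff T huH hx] at hu
    rw [Vx_iff T hv hx] at hvx
    rw [Z_iff T huH] at huZ
    -- it suffices to compare `u` and `x` from `v`
    suffices hgoal : v ≠ u → (T.rel v u ↔ T.rel v x) by
      clear hX hs t ha hb hab hc hcX huZ huy hvx hnp hH h3
      constructor
      · intro z hz
        rcases hz with rfl | rfl
        · simp
        · simp [hx]
      · intro w hw hwX p hp q hq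
        have hwu : w ≠ u := by grind
        have hwx : w ≠ x := by grind
        have key : T.rel w u ↔ T.rel w x := by
          rcases hw with h | h | h
          · exact absurd h hwu
          · rw [h]
            exact hgoal (h ▸ hwu)
          · exact hu w h hwx
        rcases hp with rfl | rfl <;> rcases hq with rfl | rfl <;> tauto
    intro hvu
    rcases t with t | t
    · by_cases huX : u ∈ X
      · by_cases hy : ∃ y ∈ H, y ∈ X
        · obtain ⟨y, hy, hyX⟩ := hy
          have hxy : x = y := by
            apply huy y hy
            rw [Vx_iff T huH hy]
            grind
          subst hxy
          by_cases hvX : v ∈ X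
          · exfalso
            apply hvx
            grind
          · grind
        · exfalso
          have hvX : v ∈ X := by grind
          apply hvx
          grind
      · have : v ∈ X ∧ ∃ y ∈ H, y ∈ X := by grind
        obtain ⟨hvX, y, hy, hyX⟩ := this
        have hyx : y ≠ x := by
          rintro rfl
          apply hvx
          grind
        have e1 := hX u (by grind) huX v hvX y hyX
        have e2 := hX u (by grind) huX y hyX v hvX
        have e3 := hX x (by grind) (by grind) v hvX y hyX
        have e4 := hX x (by grind) (by grind) y hyX v hvX
        have e5 := hu y hy hyx
        have f1 := T.flip hvu
        have f2 := T.flip (show v ≠ x by grind)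
        have f3 := T.flip hyx
        have f4 := T.flip (show y ≠ u by grind)
        tauto
    · by_cases huX : u ∈ X
      · grind
      · exfalso
        apply huZ
        grind
end

section
/- Let G be a prime tournament which is not isomorphic to T_n, U_n, or W_n for any odd n, and let H be a prime subtournament of G with 5 ≤ |V(H)| ≤ |V(G)| − 1. Then there exists a prime subtournament of G with |V(H)| + 1 vertices that has a subtournament isomorphic to H. -/
namespace Tournament
section Grow
variable {V : Type} (T : Tournament V)

/-- `a` and `b` are not distinguished by any third vertex of `S`. -/
def Tw (S : Set V) (a b : V) : Prop :=
  ∀ y ∈ S, y ≠ a → y ≠ b → (T.rel y a ↔ T.rel y b)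

/-- `v` is a source or a sink relative to `S`. -/
def Zs (S : Set V) (v : V) : Prop :=
  (∀ y ∈ S, y ≠ v → T.rel v y) ∨ (∀ y ∈ S, y ≠ v → T.rel y v)

/-- `A` embeds into `B`. -/
def Emb (A B : Set V) : Prop :=
  ∃ f : V → V, Set.InjOn f A ∧ (∀ v ∈ A, f v ∈ B) ∧
    ∀ u ∈ A, ∀ v ∈ A, (T.rel u v ↔ T.rel (f u) (f v))

/-- `X` is prime and contains a copy of `H`. -/
def QQ (H X : Set V) : Prop := T.PrimeOn X ∧ T.Emb H X

variable {T}
set_option linter.unusedSectionVars false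
set_option linter.unusedSimpArgs false

theorem rel_iff {u v : V} (h : u ≠ v) : T.rel u v ↔ ¬ T.rel v u :=
  ⟨T.asymm u v, fun h' => (T.total u v h).resolve_right h'⟩

theorem Tw.symm {S : Set V} {a b : V} (h : T.Tw S a b) : T.Tw S b a :=
  fun y hy h1 h2 => (h y hy h2 h1).symm

theorem Tw.mono {S S' : Set V} {a b : V} (h : T.Tw S a b) (hs : S' ⊆ S) : T.Tw S' a b :=
  fun y hy h1 h2 => h y (hs hy) h1 h2

theorem Zs.mono {S S' : Set V} {a : V} (h : T.Zs S a) (hs : S' ⊆ S) : T.Zs S' a := by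
  rcases h with h | h
  · exact Or.inl fun y hy => h y (hs hy)
  · exact Or.inr fun y hy => h y (hs hy)

variable [Fintype V]

theorem prime_notw {S : Set V} (hS : T.PrimeOn S) (h3 : 3 ≤ S.ncard) {a b : V} (ha : a ∈ S)
    (hb : b ∈ S) (hab : a ≠ b) : ¬ T.Tw S a b := by
  intro h
  have := hS.2 {a, b} ⟨by intro x hx; rcases hx with rfl | rfl <;> assumption, ?_⟩
  · have h2 : ({a, b} : Set V).ncard = 2 := Set.ncard_pair hab
    rcases this with h1 | h1
    · omega
    · rw [← h1] at h3; omega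
  · rintro v ⟨hv, hn⟩
    simp only [Set.mem_insert_iff, Set.mem_singleton_iff, not_or] at hn
    have := h v hv hn.1 hn.2
    by_cases hr : T.rel v a
    · left; intro x hx; rcases hx with rfl | rfl
      · exact hr
      · exact this.1 hr
    · right; intro x hx; rcases hx with rfl | rfl
      · exact (T.total _ _ hn.1).resolve_left hr
      · exact (T.total _ _ hn.2).resolve_left (fun h => hr (this.2 h))

theorem prime_noz {S : Set V} (hS : T.PrimeOn S) (h3 : 3 ≤ S.ncard) {a : V} (ha : a ∈ S) :
    ¬ T.Zs S a := by
  intro h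
  have hc : (S \ {a}).ncard = S.ncard - 1 := Set.ncard_sdiff_singleton_of_mem ha
  suffices hom : T.HomogOn S (S \ {a}) by
    rcases hS.2 _ hom with h1 | h1
    · omega
    · have : a ∈ S \ {a} := by rw [h1]; exact ha
      simp at this
  refine ⟨Set.sdiff_subset, ?_⟩
  · rintro v ⟨hv, hn⟩
    have : v = a := by by_contra h'; exact hn ⟨hv, h'⟩
    subst this
    rcases h with h | h
    · left; intro x hx; exact h x hx.1 hx.2
    · right; intro x hx; exact h x hx.1 hx.2

/-- restriction of homogeneous sets -/
theorem homog_inter {A S X : Set V} (h : T.HomogOn S X) (hA : A ⊆ S) : T.HomogOn A (X ∩ A) := by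
  refine ⟨Set.inter_subset_right, ?_⟩
  rintro v ⟨hv, hn⟩
  rcases h.2 v ⟨hA hv, fun h => hn ⟨h, hv⟩⟩ with h | h
  · exact Or.inl fun x hx => h x hx.1
  · exact Or.inr fun x hx => h x hx.1

theorem homog_tw {S X : Set V} (h : T.HomogOn S X) {a b : V} (ha : a ∈ X) (hb : b ∈ X)
    {y : V} (hy : y ∈ S) (hyX : y ∉ X) : T.rel y a ↔ T.rel y b := by
  rcases h.2 y ⟨hy, hyX⟩ with h | h
  · exact ⟨fun _ => h b hb, fun _ => h a ha⟩
  · exact ⟨fun h' => absurd (h a ha) (T.asymm _ _ h'), fun h' => absurd (h b hb) (T.asymm _ _ h')⟩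

theorem partition {A : Set V} (hA : T.PrimeOn A) {v : V} (hv : v ∉ A) :
    T.PrimeOn (insert v A) ∨ T.Zs A v ∨ ∃ x ∈ A, T.Tw A v x := by
  by_contra! hcon
  obtain ⟨h1, h2, h3⟩ := hcon
  apply h1
  refine ⟨Set.insert_nonempty _ _, ?_⟩
  intro X hX
  by_contra! hc
  obtain ⟨hc1, hc2⟩ := hc
  have hXA := hA.2 _ (homog_inter hX (Set.subset_insert v A))
  by_cases hvX : v ∈ X
  · have hXe : X = insert v (X ∩ A) := by
      ext y; constructor
      · intro hy
        rcases hX.1 hy with rfl | h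
        · exact Set.mem_insert _ _
        · exact Or.inr ⟨hy, h⟩
      · rintro (rfl | h)
        · exact hvX
        · exact h.1
    rcases hXA with h | h
    · rw [Set.ncard_le_one_iff_subsingleton] at h
      obtain ⟨x, hx⟩ : (X ∩ A).Nonempty := by
        by_contra he
        rw [Set.not_nonempty_iff_eq_empty] at he
        rw [he] at hXe
        rw [hXe] at hc1
        simp at hc1
      refine h3 x hx.2 ?_
      intro y hy hyv hyx
      exact homog_tw hX hvX hx.1 (Or.inr hy) (fun hyX => hyx (h ⟨hyX, hy⟩ hx))
    · rw [h] at hXe; exact hc2 hXe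
  · have hXe : X ∩ A = X := by
      apply Set.inter_eq_left.2
      intro y hy
      rcases hX.1 hy with rfl | h
      · exact absurd hy hvX
      · exact h
    rw [hXe] at hXA
    rcases hXA with h | h
    · omega
    · subst h
      apply h2
      rcases hX.2 v ⟨Set.mem_insert _ _, hvX⟩ with h | h
      · exact Or.inl fun y hy _ => h y hy
      · exact Or.inr fun y hy _ => h y hy

theorem tw_unique {A : Set V} (hA : T.PrimeOn A) (h3 : 3 ≤ A.ncard) {v x y : V} (hv : v ∉ A)
    (hx : x ∈ A) (hy : y ∈ A) (h1 : T.Tw A v x) (h2 : T.Tw A v y) : x = y := by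
  by_contra hne
  refine prime_notw hA h3 hx hy hne ?_
  intro z hz hzx hzy
  have hzv : z ≠ v := fun h => hv (h ▸ hz)
  rw [← h1 z hz hzv hzx, h2 z hz hzv hzy]

theorem tw_noz {A : Set V} (hA : T.PrimeOn A) (h3 : 3 ≤ A.ncard) {v x : V} (hv : v ∉ A)
    (hx : x ∈ A) (h1 : T.Tw A v x) : ¬ T.Zs A v := by
  intro h
  refine prime_noz hA h3 hx ?_
  have hne : ∀ z ∈ A, z ≠ v := fun z hz h => hv (h ▸ hz)
  rcases h with h | h
  · left; intro y hy hyx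
    have := h1 y hy (hne y hy) hyx
    have := h y hy (hne y hy)
    grind [rel_iff (T := T) (hne y hy), rel_iff (T := T) hyx]
  · right; intro y hy hyx
    have := h1 y hy (hne y hy) hyx
    have := h y hy (hne y hy)
    tauto

theorem pair_prime {A : Set V} (hA : T.PrimeOn A) (h3 : 3 ≤ A.ncard) {v x y : V} (hv : v ∉ A)
    (hy : y ∉ A) (hvy : y ≠ v) (hx : x ∈ A) (h1 : T.Tw A v x) (h2 : ¬ T.Tw A y x)
    (hd : ¬ (T.rel y v ↔ T.rel y x)) : T.PrimeOn (insert y (insert v A)) := by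
  refine ⟨Set.insert_nonempty _ _, ?_⟩
  intro X hX
  by_contra! hc
  obtain ⟨hc1, hc2⟩ := hc
  have hsub : A ⊆ insert y (insert v A) := fun z hz => Or.inr (Or.inr hz)
  have hXA := hA.2 _ (homog_inter hX hsub)
  have hvS : v ∈ insert y (insert v A) := Or.inr (Or.inl rfl)
  have hyS : y ∈ insert y (insert v A) := Or.inl rfl
  have hnev : ∀ z ∈ A, z ≠ v := fun z hz h => hv (h ▸ hz)
  have hney : ∀ z ∈ A, z ≠ y := fun z hz h => hy (h ▸ hz)
  rcases hXA with h | h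
  · rw [Set.ncard_le_one_iff_subsingleton] at h
    by_cases he : (X ∩ A).Nonempty
    · obtain ⟨z, hzX, hzA⟩ := he
      have hout : ∀ t ∈ A, t ≠ z → t ∉ X := fun t ht htz htX => htz (h ⟨htX, ht⟩ ⟨hzX, hzA⟩)
      have htw : ∀ u ∈ X, T.Tw A u z := fun u hu t ht htu htz =>
        homog_tw hX hu hzX (hsub ht) (hout t ht htz)
      by_cases hvX : v ∈ X
      · have hzx : z = x := tw_unique hA h3 hv hzA hx (htw v hvX) h1
        subst hzx
        by_cases hyX : y ∈ X
        · exact h2 (htw y hyX)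
        · exact hd (homog_tw hX hvX hzX hyS hyX)
      · by_cases hyX : y ∈ X
        · have hzx : z ≠ x := by rintro rfl; exact h2 (htw y hyX)
          have e1 := homog_tw hX hyX hzX hvS hvX
          have e2 := htw y hyX x hx (hney x hx) hzx.symm
          have e3 := h1 z hzA (hnev z hzA) hzx
          apply hd
          rw [rel_iff hvy, rel_iff (hney x hx).symm, e1, e2, rel_iff (hnev z hzA).symm, e3,
            rel_iff hzx]
          tauto
        · apply absurd hc1
          rw [not_lt, Set.ncard_le_one_iff_subsingleton]
          have : X ⊆ X ∩ A := by
            intro t ht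
            rcases hX.1 ht with rfl | rfl | h'
            · exact absurd ht hyX
            · exact absurd ht hvX
            · exact ⟨ht, h'⟩
          exact h.anti this
    · rw [Set.not_nonempty_iff_eq_empty] at he
      have hout : ∀ t ∈ A, t ∉ X := fun t ht htX => by
        have : t ∈ X ∩ A := ⟨htX, ht⟩
        rw [he] at this; exact this
      have hXsub : X ⊆ {y, v} := by
        intro t ht
        rcases hX.1 ht with rfl | rfl | h'
        · simp
        · simp
        · exact absurd ht (hout t h')
      by_cases hvX : v ∈ X
      · by_cases hyX : y ∈ X
        · apply h2
          intro t ht h1' h2'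
          rw [homog_tw hX hyX hvX (hsub ht) (hout t ht), h1 t ht (hnev t ht) h2']
        · have : X ⊆ {v} := by
            intro t ht
            rcases hXsub ht with rfl | h
            · exact absurd ht hyX
            · exact h
          have := Set.ncard_le_ncard this
          rw [Set.ncard_singleton] at this; omega
      · have : X ⊆ {y} := by
          intro t ht
          rcases hXsub ht with h | rfl
          · exact h
          · exact absurd ht hvX
        have := Set.ncard_le_ncard this
        rw [Set.ncard_singleton] at this; omega
  · have hAX : A ⊆ X := Set.inter_eq_right.1 h
    by_cases hvX : v ∈ X
    · have hyX : y ∉ X := by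
        intro hyX
        apply hc2
        apply Set.Subset.antisymm hX.1
        rintro t (rfl | rfl | ht)
        · exact hyX
        · exact hvX
        · exact hAX ht
      exact hd (homog_tw hX hvX (hAX hx) hyS hyX)
    · apply tw_noz hA h3 hv hx h1
      rcases hX.2 v ⟨hvS, hvX⟩ with h | h
      · exact Or.inl fun t ht _ => h t (hAX ht)
      · exact Or.inr fun t ht _ => h t (hAX ht)

/-- Ehrenfeucht--Rozenberg growing step. -/
theorem grow_step {A R : Set V} (hA : T.PrimeOn A) (h3 : 3 ≤ A.ncard) (hR : T.PrimeOn R)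
    (hAR : A ⊆ R) (hne : A ≠ R) :
    (∃ v ∈ R, v ∉ A ∧ T.PrimeOn (insert v A)) ∨
    (∃ v ∈ R, ∃ y ∈ R, v ∉ A ∧ y ∉ A ∧ y ≠ v ∧ T.PrimeOn (insert y (insert v A))) := by
  by_contra! hcon
  obtain ⟨hs, hp⟩ := hcon
  have hVx : ∀ x ∈ A, ∀ v ∈ R, v ∉ A → ¬ T.Tw A v x := by
    intro x hx v hvR hv hvx
    have hom : T.HomogOn R {t | t = x ∨ (t ∈ R ∧ t ∉ A ∧ T.Tw A t x)} := by
      constructor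
      · rintro t (rfl | ht)
        · exact hAR hx
        · exact ht.1
      · rintro y ⟨hyR, hyn⟩
        simp only [Set.mem_ofPred_eq, not_or, not_and] at hyn
        have key : ∀ t ∈ R, t ∉ A → T.Tw A t x → (T.rel y t ↔ T.rel y x) := by
          intro t htR htA htx
          by_cases hyA : y ∈ A
          · exact htx y hyA (fun h => htA (h ▸ hyA)) hyn.1
          · by_contra hd
            have hty : y ≠ t := by rintro rfl; exact hyn.2 hyR htA htx
            exact hp t htR y hyR htA hyA hty
              (pair_prime hA h3 htA hyA hty hx htx (hyn.2 hyR hyA) hd)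
        by_cases hr : T.rel y x
        · left; rintro t (rfl | ht)
          · exact hr
          · exact (key t ht.1 ht.2.1 ht.2.2).2 hr
        · right; rintro t (rfl | ht)
          · exact (T.total _ _ hyn.1).resolve_left hr
          · refine (T.total y t ?_).resolve_left (fun h => hr ((key t ht.1 ht.2.1 ht.2.2).1 h))
            rintro rfl; exact hyn.2 hyR ht.2.1 ht.2.2
    rcases hR.2 _ hom with h | h
    · rw [Set.ncard_le_one_iff_subsingleton] at h
      have := h (show x ∈ _ from Or.inl rfl) (show v ∈ _ from Or.inr ⟨hvR, hv, hvx⟩)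
      exact hv (this ▸ hx)
    · have : A ⊆ {x} := by
        intro a ha
        have : a ∈ R := hAR ha
        rw [← h] at this
        rcases this with h | h
        · exact h
        · exact absurd ha h.2.1
      have := Set.ncard_le_ncard this
      rw [Set.ncard_singleton] at this; omega
  suffices hom : T.HomogOn R A by
    rcases hR.2 _ hom with h | h
    · omega
    · exact hne h
  refine ⟨hAR, ?_⟩
  · rintro v ⟨hvR, hv⟩
    have hnev : ∀ z ∈ A, z ≠ v := fun z hz h => hv (h ▸ hz)
    rcases partition hA hv with h | h | ⟨x, hx, h⟩
    · exact absurd h (hs v hvR hv)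
    · rcases h with h | h
      · exact Or.inl fun t ht => h t ht (hnev t ht)
      · exact Or.inr fun t ht => h t ht (hnev t ht)
    · exact absurd h (hVx x hx v hvR hv)

theorem Emb.refl (A : Set V) : T.Emb A A :=
  ⟨id, Set.injOn_id A, fun _ h => h, fun _ _ _ _ => Iff.rfl⟩

theorem Emb.trans {A B C : Set V} (h1 : T.Emb A B) (h2 : T.Emb B C) : T.Emb A C := by
  obtain ⟨f, f1, f2, f3⟩ := h1
  obtain ⟨g, g1, g2, g3⟩ := h2
  refine ⟨g ∘ f, fun a ha b hb h => f1 ha hb (g1 (f2 a ha) (f2 b hb) h), fun v hv => g2 _ (f2 v hv),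
    fun u hu v hv => ?_⟩
  rw [f3 u hu v hv, g3 _ (f2 u hu) _ (f2 v hv)]; rfl

theorem Emb.mono {A B C : Set V} (h1 : T.Emb A B) (h2 : B ⊆ C) : T.Emb A C := by
  obtain ⟨f, f1, f2, f3⟩ := h1
  exact ⟨f, f1, fun v hv => h2 (f2 v hv), f3⟩

theorem prime_image {A : Set V} (hA : T.PrimeOn A) {f : V → V}
    (f3 : ∀ u ∈ A, ∀ v ∈ A, (T.rel u v ↔ T.rel (f u) (f v))) : T.PrimeOn (f '' A) := by
  refine ⟨hA.1.image f, ?_⟩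
  intro X hX
  have hXe : X = f '' (A ∩ f ⁻¹' X) := by
    ext y; constructor
    · intro hy
      obtain ⟨a, ha, rfl⟩ := hX.1 hy
      exact ⟨a, ⟨ha, hy⟩, rfl⟩
    · rintro ⟨a, ha, rfl⟩; exact ha.2
  have hom : T.HomogOn A (A ∩ f ⁻¹' X) := by
    refine ⟨Set.inter_subset_left, ?_⟩
    rintro v ⟨hv, hn⟩
    rcases hX.2 (f v) ⟨⟨v, hv, rfl⟩, fun h => hn ⟨hv, h⟩⟩ with h | h
    · exact Or.inl fun x hx => (f3 v hv x hx.1).2 (h _ hx.2)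
    · exact Or.inr fun x hx => (f3 x hx.1 v hv).2 (h _ hx.2)
  rcases hA.2 _ hom with h | h
  · left; rw [hXe]; exact (Set.ncard_image_le).trans h
  · right; rw [hXe, h]

theorem QQ.up {H X Y : Set V} (h : T.QQ H X) (hXY : X ⊆ Y) (hY : T.PrimeOn Y) : T.QQ H Y :=
  ⟨hY, h.2.mono hXY⟩

theorem QQ.card {H X : Set V} (h : T.QQ H X) : H.ncard ≤ X.ncard := by
  obtain ⟨_, f, f1, f2, _⟩ := h
  exact Set.ncard_le_ncard_of_injOn f f2 f1

theorem QQ.swap {H X : Set V} (h : T.QQ H X) {x u : V} (hx : x ∈ X) (hu : u ∉ X)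
    (hT : T.Tw X u x) : T.QQ H (insert u (X \ {x})) := by
  classical
  let f : V → V := fun t => if t = x then u else t
  have fx : f x = u := by simp [f]
  have fo : ∀ t, t ≠ x → f t = t := by intro t ht; simp [f, ht]
  have f1 : Set.InjOn f X := by
    intro a ha b hb hab
    by_cases h1 : a = x <;> by_cases h2 : b = x
    · rw [h1, h2]
    · rw [h1, fx, fo b h2] at hab; exact absurd (hab ▸ hb) hu
    · rw [h2, fx, fo a h1] at hab; exact absurd (hab ▸ ha) hu
    · rwa [fo a h1, fo b h2] at hab
  have f2 : f '' X = insert u (X \ {x}) := by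
    ext y; constructor
    · rintro ⟨a, ha, rfl⟩
      by_cases h1 : a = x
      · rw [h1, fx]; exact Or.inl rfl
      · rw [fo a h1]; exact Or.inr ⟨ha, h1⟩
    · rintro (rfl | ⟨hy, hyx⟩)
      · exact ⟨x, hx, fx⟩
      · exact ⟨y, hy, fo y hyx⟩
  have f3 : ∀ a ∈ X, ∀ b ∈ X, (T.rel a b ↔ T.rel (f a) (f b)) := by
    intro a ha b hb
    have hau : a ≠ u := fun h => hu (h ▸ ha)
    have hbu : b ≠ u := fun h => hu (h ▸ hb)
    by_cases h1 : a = x <;> by_cases h2 : b = x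
    · subst h1; subst h2; rw [fx]
      exact ⟨fun h => absurd h (T.asymm _ _ h), fun h => absurd h (T.asymm _ _ h)⟩
    · subst h1; rw [fx, fo b h2]
      rw [rel_iff (Ne.symm h2), rel_iff hbu.symm, hT b hb hbu h2]
    · subst h2; rw [fx, fo a h1]
      exact (hT a ha hau h1).symm
    · rw [fo a h1, fo b h2]
  rw [← f2]
  refine ⟨prime_image h.1 f3, h.2.trans ⟨f, f1, fun v hv => ⟨v, hv, rfl⟩, f3⟩⟩

/-- Removing the pair `a, b` from `S` leaves a prime set containing a copy of `H`. -/
def Ed (T : Tournament V) (H S : Set V) (a b : V) : Prop :=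
  a ∈ S ∧ b ∈ S ∧ a ≠ b ∧ T.QQ H (S \ {a, b})

theorem Ed.symm {H S : Set V} {a b : V} (h : T.Ed H S a b) : T.Ed H S b a := by
  refine ⟨h.2.1, h.1, h.2.2.1.symm, ?_⟩
  rw [Set.pair_comm]; exact h.2.2.2

theorem Ed.card {H S : Set V} {a b : V} (h : T.Ed H S a b) :
    (S \ {a, b}).ncard + 2 = S.ncard := by
  obtain ⟨ha, hb, hab, _⟩ := h
  have := Set.ncard_sdiff_add_ncard_of_subset (s := {a, b}) (t := S) (by
    intro x hx; rcases hx with rfl | rfl <;> assumption)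
  rwa [Set.ncard_pair hab] at this

theorem Ed.step {H S : Set V} (hno : ∀ v ∈ S, ¬ T.QQ H (S \ {v})) {v u : V}
    (h : T.Ed H S v u) : T.Zs (S \ {v}) u ∨ ∃ x, x ≠ u ∧ T.Ed H S v x ∧ T.Tw (S \ {v}) u x := by
  obtain ⟨hv, hu, hvu, hq⟩ := h
  have hins : insert u (S \ {v, u}) = S \ {v} := by
    ext t; simp only [Set.mem_insert_iff, Set.mem_sdiff, Set.mem_singleton_iff]; grind
  have hun : u ∉ S \ {v, u} := by simp
  rcases partition hq.1 hun with h | h | ⟨x, hx, h⟩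
  · rw [hins] at h
    exact absurd (hq.up (by rw [← hins]; exact Set.subset_insert _ _) h) (hno v hv)
  · left
    rcases h with h | h
    · exact Or.inl fun y hy hyu => h y (by simp at hy ⊢; tauto) hyu
    · exact Or.inr fun y hy hyu => h y (by simp at hy ⊢; tauto) hyu
  · right
    have hsw := hq.swap hx hun h
    have hx' : x ∈ S ∧ x ≠ v ∧ x ≠ u := by simpa using hx
    refine ⟨x, hx'.2.2, ⟨hv, hx'.1, hx'.2.1.symm, ?_⟩, ?_⟩
    · convert hsw using 1
      ext t; simp only [Set.mem_insert_iff, Set.mem_sdiff, Set.mem_singleton_iff]; grind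
    · intro y hy hyu hyx
      exact h y (by simp at hy ⊢; tauto) hyu hyx

theorem Ed.noz {H S : Set V} (h5 : 5 ≤ S.ncard) {v u x : V} (h1 : T.Ed H S v u)
    (h2 : T.Ed H S v x) (hux : u ≠ x) : ¬ T.Zs (S \ {v}) u := by
  intro h
  have hc := h2.card
  refine prime_noz h2.2.2.2.1 (by omega) (a := u) ?_ (h.mono ?_)
  · have := h1.2.2.1; have := h1.2.1; simp; grind
  · intro t ht; simp at ht ⊢; tauto

theorem Ed.deg {H S : Set V} (h5 : 5 ≤ S.ncard) {v u x z : V} (h : T.Tw (S \ {v}) u x)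
    (h1 : T.Ed H S v u) (h2 : T.Ed H S v x) (h3 : T.Ed H S v z) (hux : u ≠ x) (huz : u ≠ z)
    (hxz : x ≠ z) : False := by
  have hc := h3.card
  refine prime_notw h3.2.2.2.1 (by omega) (a := u) (b := x) ?_ ?_ hux (h.mono ?_)
  · have := h1.2.2.1; have := h1.2.1; simp; grind
  · have := h2.2.2.1; have := h2.2.1; simp; grind
  · intro t ht; simp at ht ⊢; tauto

theorem Ed.tw {H S : Set V} (h5 : 5 ≤ S.ncard) (hno : ∀ v ∈ S, ¬ T.QQ H (S \ {v})) {v u x : V}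
    (h1 : T.Ed H S v u) (h2 : T.Ed H S v x) (hux : u ≠ x) : T.Tw (S \ {v}) u x := by
  rcases h1.step hno with h | ⟨y, hyu, h, ht⟩
  · exact absurd h (h1.noz h5 h2 hux)
  · by_cases hxy : y = x
    · rwa [hxy] at ht
    · exact (Ed.deg h5 ht h1 h h2 hyu.symm hux hxy).elim

/-- A path of length `m` in the graph `Ed`. -/
def IsPath (T : Tournament V) (H S : Set V) (m : ℕ) (c : ℕ → V) : Prop :=
  (∀ i j, i < m → j < m → c i = c j → i = j) ∧ ∀ i, i + 1 < m → T.Ed H S (c i) (c (i + 1))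

theorem IsPath.le {H S : Set V} {m : ℕ} {c : ℕ → V} (h : T.IsPath H S m c) :
    m ≤ Fintype.card V := by
  have : Function.Injective (fun i : Fin m => c i) := by
    intro i j hij; exact Fin.ext (h.1 _ _ i.2 j.2 hij)
  simpa using Fintype.card_le_of_injective _ this

theorem IsPath.rev {H S : Set V} {m : ℕ} {c : ℕ → V} (h : T.IsPath H S m c) :
    T.IsPath H S m (fun i => c (m - 1 - i)) := by
  constructor
  · intro i j hi hj hij
    have := h.1 _ _ (by omega) (by omega) hij
    omega
  · intro i hi
    have := h.2 (m - 1 - (i + 1)) (by omega)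
    rw [show m - 1 - (i + 1) + 1 = m - 1 - i by omega] at this
    exact this.symm

theorem path_end {H S : Set V} (h5 : 5 ≤ S.ncard) (hno : ∀ v ∈ S, ¬ T.QQ H (S \ {v}))
    {m : ℕ} (hm : 2 ≤ m) {c : ℕ → V} (h : T.IsPath H S m c)
    (hmax : ∀ c', ¬ T.IsPath H S (m + 1) c') :
    T.Zs (S \ {c 0}) (c 1) ∨ (3 ≤ m ∧ T.Ed H S (c 0) (c (m - 1))) := by
  rcases (h.2 0 (by omega)).step hno with hz | ⟨x, hx1, hE, -⟩
  · exact Or.inl hz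
  · right
    by_cases hx : ∃ j, j < m ∧ c j = x
    · obtain ⟨j, hj, rfl⟩ := hx
      have hj0 : j ≠ 0 := by rintro rfl; exact hE.2.2.1 rfl
      have hj1 : j ≠ 1 := by rintro rfl; exact hx1 rfl
      by_cases hjm : j + 1 < m
      · exfalso
        have e1 := (h.2 (j - 1) (by omega)).symm
        rw [show j - 1 + 1 = j by omega] at e1
        have e2 := h.2 j hjm
        have n1 : c (j - 1) ≠ c (j + 1) := fun hh => by
          have := h.1 _ _ (by omega) (by omega) hh; omega
        have n2 : c (j - 1) ≠ c 0 := fun hh => by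
          have := h.1 _ _ (by omega) (by omega) hh; omega
        have n3 : c (j + 1) ≠ c 0 := fun hh => by
          have := h.1 _ _ (by omega) (by omega) hh; omega
        exact Ed.deg h5 (Ed.tw h5 hno e1 e2 n1) e1 e2 hE.symm n1 n2 n3
      · have : j = m - 1 := by omega
        subst this
        exact ⟨by omega, hE⟩
    · exfalso
      push Not at hx
      refine hmax (fun i => if i = 0 then x else c (i - 1)) ⟨?_, ?_⟩
      · intro i j hi hj hij
        by_cases hi0 : i = 0 <;> by_cases hj0 : j = 0
        · omega
        · simp only [hi0, hj0, if_true, if_false] at hij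
          exact absurd hij.symm (hx _ (by omega))
        · simp only [hi0, hj0, if_true, if_false] at hij
          exact absurd hij (hx _ (by omega))
        · simp only [hi0, hj0, if_false] at hij
          have := h.1 _ _ (by omega) (by omega) hij
          omega
      · intro i hi
        by_cases hi0 : i = 0
        · subst hi0; simpa using hE.symm
        · have := h.2 (i - 1) (by omega)
          simp only [hi0, if_false, Nat.add_eq_zero_iff, false_and, Nat.add_sub_cancel]
          rwa [show i - 1 + 1 = i by omega] at this

/-- A maximal path, oriented forwards. -/
structure Chain (T : Tournament V) (H S : Set V) (m : ℕ) (c : ℕ → V) : Prop where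
  two : 2 ≤ m
  inj : ∀ i j, i < m → j < m → c i = c j → i = j
  ed : ∀ i, i + 1 < m → T.Ed H S (c i) (c (i + 1))
  tw : ∀ i, i + 2 < m → T.Tw (S \ {c (i + 1)}) (c i) (c (i + 2))
  ends : (T.Zs (S \ {c 0}) (c 1) ∧ T.Zs (S \ {c (m - 1)}) (c (m - 2))) ∨
    (3 ≤ m ∧ T.Tw (S \ {c 0}) (c 1) (c (m - 1)) ∧ T.Tw (S \ {c (m - 1)}) (c (m - 2)) (c 0))
  fwd : T.rel (c 0) (c 1)

theorem exists_chain {H S : Set V} (h5 : 5 ≤ S.ncard) (hS : T.PrimeOn S)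
    (hno : ∀ v ∈ S, ¬ T.QQ H (S \ {v})) {a b : V} (hab : T.Ed H S a b) :
    ∃ m c, T.Chain H S m c := by
  classical
  have hex : ∃ m, 2 ≤ m ∧ (∃ c, T.IsPath H S m c) ∧ ∀ c', ¬ T.IsPath H S (m + 1) c' := by
    have h2 : ∃ c, T.IsPath H S 2 c := by
      refine ⟨fun i => if i = 0 then a else b, ?_, ?_⟩
      · intro i j hi hj hij
        have := hab.2.2.1
        by_cases hi0 : i = 0 <;> by_cases hj0 : j = 0 <;> simp [hi0, hj0] at hij <;>
          first | omega | exact absurd hij this | exact absurd hij.symm this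
      · intro i hi
        have : i = 0 := by omega
        subst this; simpa using hab
    by_contra! hcon
    have : ∀ k, ∃ c, T.IsPath H S (k + 2) c := by
      intro k; induction k with
      | zero => exact h2
      | succ k ih => exact hcon (k + 2) (by omega) ih
    obtain ⟨c, hc⟩ := this (Fintype.card V)
    have := hc.le; omega
  obtain ⟨m, hm, ⟨c, hc⟩, hmax⟩ := hex
  -- everything but orientation
  have key : ∀ c, T.IsPath H S m c → T.rel (c 0) (c 1) → T.Chain H S m c := by
    intro c hc hr
    have htw : ∀ i, i + 2 < m → T.Tw (S \ {c (i + 1)}) (c i) (c (i + 2)) := by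
      intro i hi
      exact Ed.tw h5 hno (hc.2 i (by omega)).symm (hc.2 (i + 1) (by omega))
        (fun hh => by have := hc.1 _ _ (by omega) (by omega) hh; omega)
    refine ⟨hm, hc.1, hc.2, htw, ?_, hr⟩
    have e1 := path_end h5 hno hm hc hmax
    have e2 := path_end h5 hno hm hc.rev hmax
    simp only [Nat.sub_zero, Nat.sub_self] at e2
    rw [show m - 1 - 1 = m - 2 by omega] at e2
    have d0 := hc.2 0 (by omega)
    have dm := (hc.2 (m - 2) (by omega)).symm
    rw [show m - 2 + 1 = m - 1 by omega] at dm
    have cyc : 3 ≤ m → T.Ed H S (c 0) (c (m - 1)) →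
        (3 ≤ m ∧ T.Tw (S \ {c 0}) (c 1) (c (m - 1)) ∧
          T.Tw (S \ {c (m - 1)}) (c (m - 2)) (c 0)) := by
      intro h3 hE
      refine ⟨h3, Ed.tw h5 hno d0 hE ?_, Ed.tw h5 hno dm hE.symm ?_⟩
      · intro hh; have := hc.1 _ _ (by omega) (by omega) hh; omega
      · intro hh; have := hc.1 _ _ (by omega) (by omega) hh; omega
    rcases e1 with e1 | e1
    · rcases e2 with e2 | e2
      · exact Or.inl ⟨e1, e2⟩
      · exact Or.inr (cyc e2.1 e2.2.symm)
    · exact Or.inr (cyc e1.1 e1.2)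
  by_cases hr : T.rel (c 0) (c 1)
  · exact ⟨m, c, key c hc hr⟩
  · by_cases hr' : T.rel (c (m - 1)) (c (m - 2))
    · exact ⟨m, _, key _ hc.rev (by simpa [show m - 1 - 1 = m - 2 by omega] using hr')⟩
    · exfalso
      -- orientation is constant along the path
      have hne : ∀ i j, i < m → j < m → i ≠ j → c i ≠ c j :=
        fun i j hi hj hij hh => hij (hc.1 _ _ hi hj hh)
      have hall : ∀ i, i + 1 < m → T.rel (c (i + 1)) (c i) := by
        intro i; induction i with
        | zero =>
          intro hi
          exact (T.total _ _ (hne 0 1 (by omega) (by omega) (by omega))).resolve_left hr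
        | succ i ih =>
          intro hi
          by_contra hn
          have ih := ih (by omega)
          have h1 : T.rel (c (i + 1)) (c (i + 2)) :=
            (T.total _ _ (hne _ _ (by omega) (by omega) (by omega))).resolve_right hn
          have htw := Ed.tw h5 hno (hc.2 i (by omega)).symm (hc.2 (i + 1) (by omega))
            (hne _ _ (by omega) (by omega) (by omega))
          refine prime_notw hS (by omega) (hc.2 i (by omega)).1 (hc.2 (i + 1) (by omega)).2.1
            (hne _ _ (by omega) (by omega) (by omega)) ?_
          intro y hy h1' h2'
          by_cases hyc : y = c (i + 1)
          · subst hyc; exact ⟨fun _ => h1, fun _ => ih⟩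
          · exact htw y ⟨hy, hyc⟩ h1' h2'
      have := hall (m - 2) (by omega)
      rw [show m - 2 + 1 = m - 1 by omega] at this
      exact hr' this

theorem Chain.mem {H S : Set V} {m : ℕ} {c : ℕ → V} (h : T.Chain H S m c) {i : ℕ} (hi : i < m) :
    c i ∈ S := by
  have h2 := h.two
  by_cases h1 : i + 1 < m
  · exact (h.ed i h1).1
  · have := (h.ed (i - 1) (by omega)).2.1
    rwa [show i - 1 + 1 = i by omega] at this

theorem Chain.ne {H S : Set V} {m : ℕ} {c : ℕ → V} (h : T.Chain H S m c) {i j : ℕ} (hi : i < m)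
    (hj : j < m) (hij : i ≠ j) : c i ≠ c j := fun hh => hij (h.inj _ _ hi hj hh)

theorem Chain.switch {H S : Set V} (h5 : 5 ≤ S.ncard) (hS : T.PrimeOn S) {m : ℕ} {c : ℕ → V}
    (h : T.Chain H S m c) {i : ℕ} (hi : i + 2 < m) :
    ¬ (T.rel (c (i + 1)) (c i) ↔ T.rel (c (i + 1)) (c (i + 2))) := by
  intro hh
  refine prime_notw hS (by omega) (h.mem (i := i) (by omega)) (h.mem hi)
    (h.ne (by omega) (by omega) (by omega)) ?_
  intro y hy h1 h2
  by_cases hyc : y = c (i + 1)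
  · subst hyc; exact hh
  · exact h.tw i hi y ⟨hy, hyc⟩ h1 h2

theorem Chain.shift {H S : Set V} {m : ℕ} {c : ℕ → V}
    (h : T.Chain H S m c) {i k : ℕ} (hi : i + 2 < m) (hk : k < m) (h0 : k ≠ i) (h1 : k ≠ i + 1)
    (h2 : k ≠ i + 2) : T.rel (c k) (c i) ↔ T.rel (c k) (c (i + 2)) :=
  h.tw i hi (c k) ⟨h.mem hk, h.ne hk (by omega) h1⟩ (h.ne hk (by omega) h0) (h.ne hk hi h2)

theorem Chain.opp {H S : Set V} (h5 : 5 ≤ S.ncard) (hS : T.PrimeOn S) {m : ℕ} {c : ℕ → V}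
    (h : T.Chain H S m c) {i j : ℕ} (hij : i < j) (hj : j < m) (hp : i % 2 ≠ j % 2) :
    T.rel (c i) (c j) := by
  have h1 : ∀ i, i + 1 < m → T.rel (c i) (c (i + 1)) := by
    intro i; induction i with
    | zero => intro _; exact h.fwd
    | succ i ih =>
      intro hi
      have ih := ih (by omega)
      have := h.switch h5 hS (i := i) (by omega)
      have := T.asymm _ _ ih
      tauto
  have h2 : ∀ d, i + 1 + 2 * d < m → T.rel (c i) (c (i + 1 + 2 * d)) := by
    intro d; induction d with
    | zero => intro hd; exact h1 i (by omega)
    | succ d ih =>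
      intro hd
      have ih := ih (by omega)
      have := h.shift (i := i + 1 + 2 * d) (k := i) (by omega) (by omega) (by omega) (by omega)
        (by omega)
      exact this.1 ih
  have := h2 ((j - i - 1) / 2) (by omega)
  rwa [show i + 1 + 2 * ((j - i - 1) / 2) = j by omega] at this

theorem Chain.same {H S : Set V} {m : ℕ} {c : ℕ → V}
    (h : T.Chain H S m c) {i j : ℕ} (hij : i < j) (hj : j < m) (hp : i % 2 = j % 2) :
    T.rel (c i) (c j) ↔ T.rel (c (i % 2)) (c (i % 2 + 2)) := by
  have h1 : ∀ d i, i + 2 + 2 * d < m →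
      (T.rel (c i) (c (i + 2 + 2 * d)) ↔ T.rel (c i) (c (i + 2))) := by
    intro d i; induction d with
    | zero => intro hd; exact Iff.rfl
    | succ d ih =>
      intro hd
      rw [← ih (by omega)]
      exact (h.shift (i := i + 2 + 2 * d) (k := i) (by omega) (by omega) (by omega) (by omega)
        (by omega)).symm
  have h2 : ∀ d i, i + 2 * d + 2 < m →
      (T.rel (c (i + 2 * d)) (c (i + 2 * d + 2)) ↔ T.rel (c i) (c (i + 2))) := by
    intro d i; induction d with
    | zero => intro hd; exact Iff.rfl
    | succ d ih =>
      intro hd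
      rw [← ih (by omega), ← h1 1 (i + 2 * d) (by omega)]
      have := h.shift (i := i + 2 * d) (k := i + 2 * d + 4) (by omega) (by omega) (by omega)
        (by omega) (by omega)
      have e1 := rel_iff (T := T) (h.ne (i := i + 2 * d) (j := i + 2 * d + 4) (by omega) (by omega)
        (by omega))
      have e2 := rel_iff (T := T) (h.ne (i := i + 2 * d + 2) (j := i + 2 * d + 4) (by omega)
        (by omega) (by omega))
      show T.rel (c (i + 2 * d + 2)) (c (i + 2 * d + 4)) ↔ T.rel (c (i + 2 * d)) (c (i + 2 * d + 4))
      tauto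
  have e1 := h1 ((j - i - 2) / 2) i (by omega)
  rw [show i + 2 + 2 * ((j - i - 2) / 2) = j by omega] at e1
  have e2 := h2 (i / 2) (i % 2) (by omega)
  rw [show i % 2 + 2 * (i / 2) = i by omega] at e2
  rw [e1, e2]

theorem Chain.out {H S : Set V} {m : ℕ} {c : ℕ → V}
    (h : T.Chain H S m c) {y : V} (hy : y ∈ S) (hn : ∀ i, i < m → y ≠ c i) {i : ℕ} (hi : i < m) :
    T.rel y (c i) ↔ T.rel y (c (i % 2)) := by
  have h2 : ∀ d i, i + 2 * d < m → (T.rel y (c (i + 2 * d)) ↔ T.rel y (c i)) := by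
    intro d i; induction d with
    | zero => intro hd; exact Iff.rfl
    | succ d ih =>
      intro hd
      rw [← ih (by omega)]
      exact (h.tw (i + 2 * d) (by omega) y ⟨hy, hn _ (by omega)⟩ (hn _ (by omega))
        (hn _ (by omega))).symm
  have e2 := h2 (i / 2) (i % 2) (by omega)
  rwa [show i % 2 + 2 * (i / 2) = i by omega] at e2

/-- `T_m` (`e` false) or `U_m` (`e` true). -/
structure IsTU (T : Tournament V) (H S : Set V) (e : Prop) (m : ℕ) (c : ℕ → V) : Prop where
  odd : m % 2 = 1
  inj : ∀ i j, i < m → j < m → c i = c j → i = j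
  mem : ∀ v, v ∈ S ↔ ∃ i, i < m ∧ c i = v
  rel : ∀ i j, i < j → j < m → (T.rel (c i) (c j) ↔ (i % 2 ≠ j % 2 ∨ (i % 2 = 1 ∧ e)))
  ed : ∀ i, i + 1 < m → T.Ed H S (c i) (c (i + 1))

/-- `W_{m+1}`. -/
structure IsW (T : Tournament V) (H S : Set V) (w : V) (m : ℕ) (c : ℕ → V) : Prop where
  even : m % 2 = 0
  inj : ∀ i j, i < m → j < m → c i = c j → i = j
  new : ∀ i, i < m → c i ≠ w
  mem : ∀ v, v ∈ S ↔ (v = w ∨ ∃ i, i < m ∧ c i = v)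
  rel : ∀ i j, i < j → j < m → T.rel (c i) (c j)
  relw : ∀ i, i < m → (T.rel (c i) w ↔ i % 2 = 1)
  ed : ∀ i, i + 1 < m → T.Ed H S (c i) (c (i + 1))

theorem Chain.classify {H S : Set V} (h5 : 5 ≤ S.ncard) (hS : T.PrimeOn S) {m : ℕ} {c : ℕ → V}
    (h : T.Chain H S m c) : (∃ e, T.IsTU H S e m c) ∨ ∃ w, T.IsW H S w m c := by
  have h2 := h.two
  have opp := fun {i j : ℕ} => h.opp h5 hS (i := i) (j := j)
  have m0 := h.mem (i := 0) (by omega)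
  have m1 := h.mem (i := 1) (by omega)
  have ml := h.mem (i := m - 1) (by omega)
  have ml2 := h.mem (i := m - 2) (by omega)
  rcases h.ends with ⟨hz0, hz1⟩ | ⟨h3, ht0, ht1⟩
  · -- leaves at both ends
    have q0 : ∀ y ∈ S, y ≠ c 0 → y ≠ c 1 → T.rel (c 1) y := by
      rcases hz0 with hz | hz
      · intro y hy y0 y1; exact hz y ⟨hy, y0⟩ y1
      · exfalso
        refine prime_noz hS (by omega) m1 (Or.inr ?_)
        intro y hy y1
        by_cases y0 : y = c 0
        · subst y0; exact h.fwd
        · exact hz y ⟨hy, y0⟩ y1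
    have hl : T.rel (c (m - 2)) (c (m - 1)) := opp (by omega) (by omega) (by omega)
    have q1 : ∀ y ∈ S, y ≠ c (m - 1) → y ≠ c (m - 2) → T.rel y (c (m - 2)) := by
      rcases hz1 with hz | hz
      · exfalso
        refine prime_noz hS (by omega) ml2 (Or.inl ?_)
        intro y hy y1
        by_cases y0 : y = c (m - 1)
        · subst y0; exact hl
        · exact hz y ⟨hy, y0⟩ y1
      · intro y hy y0 y1; exact hz y ⟨hy, y0⟩ y1
    -- out-of-path facts
    have hm2 : m ≠ 2 := by
      rintro rfl
      simp only [Nat.sub_self, show 2 - 1 = 1 from rfl] at q1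
      have hc : (S \ {c 0, c 1}).ncard + 2 = S.ncard := (h.ed 0 (by omega)).card
      rcases hS.2 (S \ {c 0, c 1}) ⟨Set.sdiff_subset, by
        rintro v ⟨hv, hn⟩
        have hv01 : v = c 0 ∨ v = c 1 := by
          by_contra hc; exact hn ⟨hv, hc⟩
        rcases hv01 with rfl | rfl
        · right; rintro x ⟨hx, hx'⟩
          simp at hx'
          exact q1 x hx hx'.2 hx'.1
        · left; rintro x ⟨hx, hx'⟩
          simp at hx'
          exact q0 x hx hx'.1 hx'.2⟩ with h' | h'
      · omega
      · rw [h'] at hc; omega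
    have hm3 : m ≠ 3 := by
      rintro rfl
      simp only [show 3 - 1 = 2 from rfl, show 3 - 2 = 1 from rfl] at q1
      have : ¬ S ⊆ {c 0, c 1, c 2} := by
        intro hs
        have h1 := Set.ncard_le_ncard hs
        have h2 := Set.ncard_insert_le (c 0) {c 1, c 2}
        have h3 := Set.ncard_insert_le (c 1) {c 2}
        rw [Set.ncard_singleton] at h3
        omega
      rw [Set.not_subset] at this
      obtain ⟨y, hy, hn⟩ := this
      simp at hn
      exact T.asymm _ _ (q0 y hy hn.1 hn.2.1) (q1 y hy hn.2.2 hn.2.1)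
    have o13 : T.rel (c 1) (c 3) := q0 _ (h.mem (by omega)) (h.ne (by omega) (by omega) (by omega))
        (h.ne (by omega) (by omega) (by omega))
    rcases Nat.mod_two_eq_zero_or_one m with hpar | hpar
    · -- m even : W
      right
      have e02 : T.rel (c 0) (c 2) := by
        have := h.same (i := 0) (j := m - 2) (by omega) (by omega) (by omega)
        exact this.1 (q1 _ m0 (h.ne (by omega) (by omega) (by omega))
          (h.ne (by omega) (by omega) (by omega)))
      have hrel : ∀ i j, i < j → j < m → T.rel (c i) (c j) := by
        intro i j hij hj
        by_cases hp : i % 2 = j % 2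
        · rw [h.same hij hj hp]
          rcases Nat.mod_two_eq_zero_or_one i with hi | hi
          · rw [hi]; exact e02
          · rw [hi]; exact o13
        · exact opp hij hj hp
      have hrw : ∀ y ∈ S, (∀ i, i < m → y ≠ c i) → ∀ i, i < m → (T.rel (c i) y ↔ i % 2 = 1) := by
        intro y hy hn i hi
        rw [rel_iff (hn i hi).symm, h.out hy hn hi]
        rcases Nat.mod_two_eq_zero_or_one i with hi' | hi'
        · rw [hi']
          have := q1 y hy (hn _ (by omega)) (hn _ (by omega))
          rw [h.out hy hn (by omega), show (m - 2) % 2 = 0 by omega] at this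
          simpa using this
        · rw [hi']
          have := T.asymm _ _ (q0 y hy (hn _ (by omega)) (hn _ (by omega)))
          simpa using this
      have hex : ∃ w ∈ S, ∀ i, i < m → w ≠ c i := by
        by_contra! hcon
        refine prime_noz hS (by omega) m0 (Or.inl ?_)
        intro y hy y0
        obtain ⟨i, hi, rfl⟩ := hcon y hy
        have : i ≠ 0 := by rintro rfl; exact y0 rfl
        exact hrel 0 i (by omega) hi
      obtain ⟨w, hw, hwn⟩ := hex
      refine ⟨w, hpar, h.inj, fun i hi => (hwn i hi).symm, ?_, hrel, hrw w hw hwn, h.ed⟩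
      intro v
      constructor
      · intro hv
        by_contra! hcon
        obtain ⟨hvw, hvn⟩ := hcon
        have hom : T.HomogOn S {y | y ∈ S ∧ ∀ i, i < m → y ≠ c i} := by
          refine ⟨fun y hy => hy.1, ?_⟩
          rintro y ⟨hy, hyn⟩
          have : ∃ i, i < m ∧ y = c i := by
            by_contra! hc; exact hyn ⟨hy, hc⟩
          obtain ⟨i, hi, rfl⟩ := this
          rcases Nat.mod_two_eq_zero_or_one i with hi' | hi'
          · right; rintro x ⟨hx, hxn⟩
            rw [rel_iff (hxn i hi), hrw x hx hxn i hi]; omega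
          · left; rintro x ⟨hx, hxn⟩
            rw [hrw x hx hxn i hi]; omega
        rcases hS.2 _ hom with h' | h'
        · rw [Set.ncard_le_one_iff_subsingleton] at h'
          exact hvw (h' ⟨hv, fun i hi => (hvn i hi).symm⟩ ⟨hw, hwn⟩)
        · rw [← h'] at m0
          exact m0.2 0 (by omega) rfl
      · rintro (rfl | ⟨i, hi, rfl⟩)
        · exact hw
        · exact h.mem hi
    · -- m odd : U
      left
      have hmem : ∀ v, v ∈ S ↔ ∃ i, i < m ∧ c i = v := by
        intro v
        constructor
        · intro hv
          by_contra! hcon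
          have hn : ∀ i, i < m → v ≠ c i := fun i hi => (hcon i hi).symm
          have a1 := T.asymm _ _ (q0 v hv (hn _ (by omega)) (hn _ (by omega)))
          have a2 := q1 v hv (hn _ (by omega)) (hn _ (by omega))
          rw [h.out hv hn (by omega), show (m - 2) % 2 = 1 by omega] at a2
          exact a1 a2
        · rintro ⟨i, hi, rfl⟩; exact h.mem hi
      refine ⟨True, hpar, h.inj, hmem, ?_, h.ed⟩
      · have e02 : ¬ T.rel (c 0) (c 2) := by
          intro h02
          refine prime_noz hS (by omega) m0 (Or.inl ?_)
          intro y hy y0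
          obtain ⟨i, hi, rfl⟩ := (hmem y).1 hy
          have : i ≠ 0 := by rintro rfl; exact y0 rfl
          by_cases hp : 0 % 2 = i % 2
          · exact (h.same (i := 0) (by omega) hi hp).2 h02
          · exact opp (by omega) hi hp
        intro i j hij hj
        by_cases hp : i % 2 = j % 2
        · rw [h.same hij hj hp]
          rcases Nat.mod_two_eq_zero_or_one i with hi | hi
          · rw [hi] at hp ⊢; simp [e02, ← hp]
          · rw [hi] at hp ⊢; simp [o13, ← hp]
        · simp [opp hij hj hp, hp]
  · -- cycle
    left
    have sw0 : ¬ (T.rel (c 0) (c 1) ↔ T.rel (c 0) (c (m - 1))) := by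
      intro hh
      refine prime_notw hS (by omega) m1 ml (h.ne (by omega) (by omega) (by omega)) ?_
      intro y hy h1 h2
      by_cases hyc : y = c 0
      · subst hyc; exact hh
      · exact ht0 y ⟨hy, hyc⟩ h1 h2
    have hpar : m % 2 = 1 := by
      by_contra hp
      exact sw0 ⟨fun _ => opp (by omega) (by omega) (by omega), fun _ => h.fwd⟩
    have hmem : ∀ v, v ∈ S ↔ ∃ i, i < m ∧ c i = v := by
      have hom : T.HomogOn S {v | ∃ i, i < m ∧ c i = v} := by
        refine ⟨?_, ?_⟩
        · rintro v ⟨i, hi, rfl⟩; exact h.mem hi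
        · rintro y ⟨hy, hyn⟩
          have hn : ∀ i, i < m → y ≠ c i := fun i hi hh => hyn ⟨i, hi, hh.symm⟩
          have e := ht0 y ⟨hy, hn _ (by omega)⟩ (hn _ (by omega)) (hn _ (by omega))
          rw [h.out hy hn (i := m - 1) (by omega), show (m - 1) % 2 = 0 by omega] at e
          have key : ∀ i, i < m → (T.rel y (c i) ↔ T.rel y (c 0)) := by
            intro i hi
            rw [h.out hy hn hi]
            rcases Nat.mod_two_eq_zero_or_one i with hi | hi
            · rw [hi]
            · rw [hi, e]
          by_cases hr : T.rel y (c 0)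
          · left; rintro x ⟨i, hi, rfl⟩; exact (key i hi).2 hr
          · right; rintro x ⟨i, hi, rfl⟩
            exact (T.total _ _ (hn i hi)).resolve_left (fun hh => hr ((key i hi).1 hh))
      rcases hS.2 _ hom with h' | h'
      · rw [Set.ncard_le_one_iff_subsingleton] at h'
        exact absurd (h' ⟨0, by omega, rfl⟩ ⟨1, by omega, rfl⟩)
          (h.ne (by omega) (by omega) (by omega))
      · intro v
        conv_lhs => rw [← h']
        rfl
    have e02 : ¬ T.rel (c 0) (c 2) := by
      intro h02
      exact sw0 ⟨fun _ => (h.same (i := 0) (j := m - 1) (by omega) (by omega) (by omega)).2 h02,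
        fun _ => h.fwd⟩
    refine ⟨False, hpar, h.inj, hmem, ?_, h.ed⟩
    intro i j hij hj
    by_cases hp : i % 2 = j % 2
    · rw [h.same hij hj hp]
      rcases Nat.mod_two_eq_zero_or_one i with hi | hi
      · rw [hi] at hp ⊢; simp [e02, ← hp]
      · rw [hi] at hp ⊢
        have h5m : 5 ≤ m := by omega
        have : ¬ T.rel (c 1) (c 3) := by
          intro h13
          have e := ht1 (c 1) ⟨m1, h.ne (by omega) (by omega) (by omega)⟩
            (h.ne (by omega) (by omega) (by omega)) (h.ne (by omega) (by omega) (by omega))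
          rw [h.same (i := 1) (j := m - 2) (by omega) (by omega) (by omega)] at e
          exact T.asymm _ _ h.fwd (e.1 h13)
        simp [this, ← hp]
    · simp [opp hij hj hp, hp]

theorem ext_half {S : Set V} {a b c d z : V} (ha : a ∈ S)
    (hac : a ≠ c) (had : a ≠ d) (hbc : b ≠ c) (hbd : b ≠ d) (hz : z ∉ S)
    {P : Set V} (hP : ∀ y, y ∈ P ↔ y ∈ S ∧ y ≠ a ∧ y ≠ b ∧ y ≠ c ∧ y ≠ d) (hPn : P.Nonempty)
    (hP1 : ∀ x ∈ P, ∀ y ∈ P, x ≠ y → ¬ T.Tw P x y) (hP2 : ∀ x ∈ P, ¬ T.Zs P x)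
    (hzK : T.Tw (S \ {c, d}) z a)
    (pa : (∃ p ∈ P, T.Tw (S \ {b}) a p) ∨ T.Zs (S \ {b}) a)
    (zH : T.Zs (S \ {a, b}) z ∨ ∃ x ∈ P, T.Tw (S \ {a, b}) z x) :
    T.Tw S z a := by
  have hzK' : ∀ y ∈ S, y ≠ c → y ≠ d → y ≠ a → (T.rel y z ↔ T.rel y a) := by
    intro y hy h1 h2 h3
    exact hzK y ⟨hy, by simp [h1, h2]⟩ (fun h => hz (h ▸ hy)) h3
  have hPz : ∀ y ∈ P, (T.rel y z ↔ T.rel y a) := by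
    intro y hy
    have := (hP y).1 hy
    exact hzK' y this.1 this.2.2.2.1 this.2.2.2.2 this.2.1
  have hPS : P ⊆ S := fun y hy => ((hP y).1 hy).1
  have hPa : ∀ y ∈ P, y ≠ a := fun y hy => ((hP y).1 hy).2.1
  have hPb : ∀ y ∈ P, y ≠ b := fun y hy => ((hP y).1 hy).2.2.1
  have hzn : ∀ y ∈ S, y ≠ z := fun y hy h => hz (h ▸ hy)
  have goal : (∀ y ∈ S, (y = c ∨ y = d) → (T.rel y z ↔ T.rel y a)) → T.Tw S z a := by
    intro hh y hy h1 h2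
    by_cases hcd : y = c ∨ y = d
    · exact hh y hy hcd
    · push Not at hcd
      exact hzK' y hy hcd.1 hcd.2 h2
  have hH : ∀ y ∈ S, (y = c ∨ y = d) → y ∈ S \ {a, b} ∧ y ∈ S \ {b} ∧ y ≠ a ∧ y ∉ P := by
    intro y hy hcd
    refine ⟨⟨hy, ?_⟩, ⟨hy, ?_⟩, ?_, ?_⟩
    · rcases hcd with rfl | rfl <;> simp <;> grind
    · rcases hcd with rfl | rfl <;> simp <;> grind
    · rcases hcd with rfl | rfl <;> grind
    · intro h; have := (hP y).1 h; tauto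
  rcases pa with ⟨p, hp, hpa⟩ | hza
  · have hpP : ∀ y ∈ P, y ≠ p → (T.rel y z ↔ T.rel y p) := by
      intro y hy hyp
      rw [hPz y hy]
      exact hpa y ⟨hPS hy, hPb y hy⟩ (hPa y hy) hyp
    rcases zH with hzz | ⟨x, hx, hxz⟩
    · exfalso
      refine hP2 p hp ?_
      rcases hzz with hzz | hzz
      · left; intro y hy hyp
        have h1 := hzz y ⟨hPS hy, by simp [hPa y hy, hPb y hy]⟩ (hzn y (hPS hy))
        have h2 := T.asymm _ _ h1
        rw [hpP y hy hyp] at h2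
        exact (T.total _ _ hyp).resolve_left h2
      · right; intro y hy hyp
        have h1 := hzz y ⟨hPS hy, by simp [hPa y hy, hPb y hy]⟩ (hzn y (hPS hy))
        rwa [hpP y hy hyp] at h1
    · have hxp : x = p := by
        by_contra hne
        refine hP1 x hx p hp hne ?_
        intro y hy h1 h2
        rw [← hpP y hy h2]
        exact (hxz y ⟨hPS hy, by simp [hPa y hy, hPb y hy]⟩ (hzn y (hPS hy)) h1).symm
      subst hxp
      apply goal
      intro y hy hcd
      obtain ⟨g1, g2, g3, g4⟩ := hH y hy hcd
      have hyx : y ≠ x := fun h => g4 (h ▸ hx)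
      rw [hxz y g1 (hzn y hy) hyx, hpa y g2 g3 hyx]
  · rcases zH with hzz | ⟨x, hx, hxz⟩
    · obtain ⟨t, ht⟩ := hPn
      have e := hPz t ht
      have t1 : t ∈ S \ {a, b} := ⟨hPS ht, by simp [hPa t ht, hPb t ht]⟩
      have t2 : t ∈ S \ {b} := ⟨hPS ht, hPb t ht⟩
      have t3 := hzn t (hPS ht)
      have t4 := hPa t ht
      apply goal
      intro y hy hcd
      obtain ⟨g1, g2, g3, g4⟩ := hH y hy hcd
      have g5 := hzn y hy
      rcases hza with hza | hza <;> rcases hzz with hzz | hzz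
      · have := T.asymm _ _ (hza y g2 g3); have := T.asymm _ _ (hzz y g1 g5); tauto
      · exact absurd (e.1 (hzz t t1 t3)) (T.asymm _ _ (hza t t2 t4))
      · exact absurd (e.2 (hza t t2 t4)) (T.asymm _ _ (hzz t t1 t3))
      · have := (hza y g2 g3); have := (hzz y g1 g5); tauto
    · exfalso
      refine hP2 x hx ?_
      have hxP : ∀ y ∈ P, y ≠ x → (T.rel y a ↔ T.rel y x) := by
        intro y hy hyx
        rw [← hPz y hy]
        exact hxz y ⟨hPS hy, by simp [hPa y hy, hPb y hy]⟩ (hzn y (hPS hy)) hyx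
      rcases hza with hzz | hzz
      · left; intro y hy hyp
        have h1 := hzz y ⟨hPS hy, hPb y hy⟩ (hPa y hy)
        have h2 := T.asymm _ _ h1
        rw [hxP y hy hyp] at h2
        exact (T.total _ _ hyp).resolve_left h2
      · right; intro y hy hyp
        have h1 := hzz y ⟨hPS hy, hPb y hy⟩ (hPa y hy)
        rwa [hxP y hy hyp] at h1

theorem ext_lemma {S : Set V} {a b c d z : V} (ha : a ∈ S) (hb : b ∈ S) (hc : c ∈ S) (hd : d ∈ S)
    (hac : a ≠ c) (had : a ≠ d) (hbc : b ≠ c) (hbd : b ≠ d) (hz : z ∉ S)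
    {P : Set V} (hP : ∀ y, y ∈ P ↔ y ∈ S ∧ y ≠ a ∧ y ≠ b ∧ y ≠ c ∧ y ≠ d) (hPn : P.Nonempty)
    (hP1 : ∀ x ∈ P, ∀ y ∈ P, x ≠ y → ¬ T.Tw P x y) (hP2 : ∀ x ∈ P, ¬ T.Zs P x)
    (pa : (∃ p ∈ P, T.Tw (S \ {b}) a p) ∨ T.Zs (S \ {b}) a)
    (pb : (∃ p ∈ P, T.Tw (S \ {a}) b p) ∨ T.Zs (S \ {a}) b)
    (pc : (∃ p ∈ P, T.Tw (S \ {d}) c p) ∨ T.Zs (S \ {d}) c)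
    (pd : (∃ p ∈ P, T.Tw (S \ {c}) d p) ∨ T.Zs (S \ {c}) d)
    (xac : ¬ T.Tw P a c) (xad : ¬ T.Tw P a d) (xbc : ¬ T.Tw P b c) (xbd : ¬ T.Tw P b d)
    (zH : T.Zs (S \ {a, b}) z ∨ ∃ x ∈ S \ {a, b}, T.Tw (S \ {a, b}) z x)
    (zK : T.Zs (S \ {c, d}) z ∨ ∃ x ∈ S \ {c, d}, T.Tw (S \ {c, d}) z x) :
    T.Zs S z ∨ ∃ x ∈ S, T.Tw S z x := by
  have hPS : P ⊆ S := fun y hy => ((hP y).1 hy).1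
  have hPH : P ⊆ S \ {a, b} := fun y hy =>
    ⟨hPS hy, fun h => h.elim ((hP y).1 hy).2.1 ((hP y).1 hy).2.2.1⟩
  have hPK : P ⊆ S \ {c, d} := fun y hy =>
    ⟨hPS hy, fun h => h.elim ((hP y).1 hy).2.2.2.1 ((hP y).1 hy).2.2.2.2⟩
  have hPb : ∀ y, y ∈ P ↔ y ∈ S ∧ y ≠ b ∧ y ≠ a ∧ y ≠ c ∧ y ≠ d := fun y => (hP y).trans
    ⟨fun h => ⟨h.1, h.2.2.1, h.2.1, h.2.2.2⟩, fun h => ⟨h.1, h.2.2.1, h.2.1, h.2.2.2⟩⟩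
  have hPc : ∀ y, y ∈ P ↔ y ∈ S ∧ y ≠ c ∧ y ≠ d ∧ y ≠ a ∧ y ≠ b := fun y => (hP y).trans
    ⟨fun h => ⟨h.1, h.2.2.2.1, h.2.2.2.2, h.2.1, h.2.2.1⟩,
      fun h => ⟨h.1, h.2.2.2.1, h.2.2.2.2, h.2.1, h.2.2.1⟩⟩
  have hPd : ∀ y, y ∈ P ↔ y ∈ S ∧ y ≠ d ∧ y ≠ c ∧ y ≠ a ∧ y ≠ b := fun y => (hPc y).trans
    ⟨fun h => ⟨h.1, h.2.2.1, h.2.1, h.2.2.2⟩, fun h => ⟨h.1, h.2.2.1, h.2.1, h.2.2.2⟩⟩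
  have hzP : ∀ y ∈ P, y ≠ z := fun y hy h => hz (hPS (h ▸ hy))
  have noz : ∀ x ∈ P, T.Tw P z x → ¬ T.Zs P z := by
    intro x hx hzx hzz
    refine hP2 x hx ?_
    rcases hzz with hzz | hzz
    · left; intro y hy hyp
      have h2 := T.asymm _ _ (hzz y hy (hzP y hy))
      rw [hzx y hy (hzP y hy) hyp] at h2
      exact (T.total _ _ hyp).resolve_left h2
    · right; intro y hy hyp
      exact (hzx y hy (hzP y hy) hyp).1 (hzz y hy (hzP y hy))
  -- the four ways of finishing
  have fa : T.Tw (S \ {c, d}) z a → (T.Zs (S \ {a, b}) z ∨ ∃ x ∈ P, T.Tw (S \ {a, b}) z x) →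
      T.Tw S z a := fun h1 h2 =>
    ext_half ha hac had hbc hbd hz hP hPn hP1 hP2 h1 pa h2
  have fb : T.Tw (S \ {c, d}) z b → (T.Zs (S \ {a, b}) z ∨ ∃ x ∈ P, T.Tw (S \ {a, b}) z x) →
      T.Tw S z b := fun h1 h2 =>
    ext_half hb hbc hbd hac had hz hPb hPn hP1 hP2 h1 pb
      (by rw [Set.pair_comm]; exact h2)
  have fc : T.Tw (S \ {a, b}) z c → (T.Zs (S \ {c, d}) z ∨ ∃ x ∈ P, T.Tw (S \ {c, d}) z x) →
      T.Tw S z c := fun h1 h2 =>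
    ext_half hc hac.symm hbc.symm had.symm hbd.symm hz hPc hPn hP1 hP2
      h1 pc h2
  have fd : T.Tw (S \ {a, b}) z d → (T.Zs (S \ {c, d}) z ∨ ∃ x ∈ P, T.Tw (S \ {c, d}) z x) →
      T.Tw S z d := fun h1 h2 =>
    ext_half hd had.symm hbd.symm hac.symm hbc.symm hz hPd hPn hP1 hP2
      h1 pd (by rw [Set.pair_comm]; exact h2)
  have splitH : ∀ x ∈ S \ {a, b}, x ∈ P ∨ x = c ∨ x = d := by
    intro x hx
    by_cases h1 : x = c
    · exact Or.inr (Or.inl h1)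
    by_cases h2 : x = d
    · exact Or.inr (Or.inr h2)
    exact Or.inl ((hP x).2 ⟨hx.1, fun h => hx.2 (Or.inl h), fun h => hx.2 (Or.inr h), h1, h2⟩)
  have splitK : ∀ x ∈ S \ {c, d}, x ∈ P ∨ x = a ∨ x = b := by
    intro x hx
    by_cases h1 : x = a
    · exact Or.inr (Or.inl h1)
    by_cases h2 : x = b
    · exact Or.inr (Or.inr h2)
    exact Or.inl ((hP x).2 ⟨hx.1, h1, h2, fun h => hx.2 (Or.inl h), fun h => hx.2 (Or.inr h)⟩)
  have cover : ∀ y ∈ S, y ∈ S \ {a, b} ∨ y ∈ S \ {c, d} := by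
    intro y hy
    by_cases h : y = a ∨ y = b
    · right; refine ⟨hy, ?_⟩
      rcases h with rfl | rfl
      · exact fun h => h.elim hac had
      · exact fun h => h.elim hbc hbd
    · left; exact ⟨hy, h⟩
  have cross : ∀ x y, T.Tw (S \ {a, b}) z x → T.Tw (S \ {c, d}) z y → x ∉ P → y ∉ P →
      T.Tw P y x := by
    intro x y h1 h2 hx hy t ht hty htx
    rw [← h1 t (hPH ht) (hzP t ht) htx, h2 t (hPK ht) (hzP t ht) hty]
  rcases zH with zH | ⟨x, hx, zH⟩
  · rcases zK with zK | ⟨y, hy, zK⟩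
    · left
      obtain ⟨t, ht⟩ := hPn
      rcases zH with zH | zH <;> rcases zK with zK | zK
      · left; intro y hy hyz
        rcases cover y hy with h | h
        · exact zH y h hyz
        · exact zK y h hyz
      · exact absurd (zH t (hPH ht) (hzP t ht)) (T.asymm _ _ (zK t (hPK ht) (hzP t ht)))
      · exact absurd (zH t (hPH ht) (hzP t ht)) (T.asymm _ _ (zK t (hPK ht) (hzP t ht)))
      · right; intro y hy hyz
        rcases cover y hy with h | h
        · exact zH y h hyz
        · exact zK y h hyz
    · right
      rcases splitK y hy with h | rfl | rfl
      · exact absurd (zH.mono hPH) (noz y h (zK.mono hPK))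
      · exact ⟨_, ha, fa zK (Or.inl zH)⟩
      · exact ⟨_, hb, fb zK (Or.inl zH)⟩
  · right
    rcases zK with zK | ⟨y, hy, zK⟩
    · rcases splitH x hx with h | rfl | rfl
      · exact absurd (zK.mono hPK) (noz x h (zH.mono hPH))
      · exact ⟨_, hc, fc zH (Or.inl zK)⟩
      · exact ⟨_, hd, fd zH (Or.inl zK)⟩
    · have nP : ∀ t, t = a ∨ t = b ∨ t = c ∨ t = d → t ∉ P := by
        intro t ht h
        obtain ⟨-, h1, h2, h3, h4⟩ := (hP t).1 h
        exact ht.elim h1 (fun h => h.elim h2 (fun h => h.elim h3 h4))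
      rcases splitH x hx with h | hxcd
      · rcases splitK y hy with h' | rfl | rfl
        · have hxy : x = y := by
            by_contra hne
            refine hP1 x h y h' hne ?_
            intro t ht h1 h2
            rw [← zH t (hPH ht) (hzP t ht) h1, zK t (hPK ht) (hzP t ht) h2]
          subst hxy
          refine ⟨x, hx.1, ?_⟩
          intro t ht h1 h2
          rcases cover t ht with h | h
          · exact zH t h h1 h2
          · exact zK t h h1 h2
        · exact ⟨_, ha, fa zK (Or.inr ⟨x, h, zH⟩)⟩
        · exact ⟨_, hb, fb zK (Or.inr ⟨x, h, zH⟩)⟩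
      · rcases splitK y hy with h' | hyab
        · rcases hxcd with rfl | rfl
          · exact ⟨_, hc, fc zH (Or.inr ⟨y, h', zK⟩)⟩
          · exact ⟨_, hd, fd zH (Or.inr ⟨y, h', zK⟩)⟩
        · exfalso
          have := cross x y zH zK (nP x (Or.inr (Or.inr hxcd)))
            (nP y (hyab.elim Or.inl (fun h => Or.inr (Or.inl h))))
          rcases hxcd with rfl | rfl <;> rcases hyab with rfl | rfl
          · exact xac this
          · exact xbc this
          · exact xad this
          · exact xbd this

theorem not_prime_insert {S : Set V} (h5 : 5 ≤ S.ncard) {z : V} (hz : z ∉ S)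
    (h : T.Zs S z ∨ ∃ x ∈ S, T.Tw S z x) : ¬ T.PrimeOn (insert z S) := by
  intro hp
  have hc : 3 ≤ (insert z S).ncard := by rw [Set.ncard_insert_of_notMem hz]; omega
  rcases h with h | ⟨x, hx, h⟩
  · refine prime_noz hp hc (Set.mem_insert _ _) ?_
    rcases h with h | h
    · left; rintro y (rfl | hy) hyz
      · exact absurd rfl hyz
      · exact h y hy hyz
    · right; rintro y (rfl | hy) hyz
      · exact absurd rfl hyz
      · exact h y hy hyz
  · refine prime_notw hp hc (Set.mem_insert _ _) (Or.inr hx) (fun h => hz (h ▸ hx)) ?_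
    rintro y (rfl | hy) h1 h2
    · exact absurd rfl h1
    · exact h y hy h1 h2

theorem ed_type {H S : Set V} {a b z : V} (hz : z ∉ S) (he : T.Ed H S a b)
    (hno : ¬ T.PrimeOn (insert z (S \ {a, b}))) :
    T.Zs (S \ {a, b}) z ∨ ∃ x ∈ S \ {a, b}, T.Tw (S \ {a, b}) z x :=
  (partition he.2.2.2.1 (fun h => hz h.1)).resolve_left hno

theorem IsTU.full {H S : Set V} {e : Prop} {m : ℕ} {c : ℕ → V} (h : T.IsTU H S e m c) {i j : ℕ}
    (hi : i < m) (hj : j < m) : T.rel (c i) (c j) ↔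
      ((i < j ∧ (i % 2 ≠ j % 2 ∨ (i % 2 = 1 ∧ e))) ∨
        (j < i ∧ ¬ (j % 2 ≠ i % 2 ∨ (j % 2 = 1 ∧ e)))) := by
  rcases lt_trichotomy i j with hl | rfl | hl
  · rw [h.rel i j hl hj]
    have : ¬ j < i := by omega
    simp only [hl, this, true_and, false_and, or_false]
  · have : ¬ T.rel (c i) (c i) := fun hh => T.asymm _ _ hh hh
    simp only [this, lt_irrefl, false_and, or_false]
  · have hne : c i ≠ c j := fun hh => by have := h.inj i j hi hj hh; omega
    rw [rel_iff hne, h.rel j i hl hi]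
    have : ¬ i < j := by omega
    simp only [hl, this, true_and, false_and, false_or]

theorem IsTU.ntw {H S Q : Set V} {e : Prop} {m : ℕ} {c : ℕ → V} (h : T.IsTU H S e m c) {i j : ℕ}
    (k : ℕ) (hi : i < m) (hj : j < m) (hk : k < m) (hQ : c k ∈ Q) (hki : k ≠ i) (hkj : k ≠ j)
    (hne : ∀ e : Prop, ¬ ((((k < i ∧ (k % 2 ≠ i % 2 ∨ (k % 2 = 1 ∧ e))) ∨
        (i < k ∧ ¬ (i % 2 ≠ k % 2 ∨ (i % 2 = 1 ∧ e))))) ↔ (((k < j ∧ (k % 2 ≠ j % 2 ∨ (k % 2 = 1 ∧ e))) ∨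
        (j < k ∧ ¬ (j % 2 ≠ k % 2 ∨ (j % 2 = 1 ∧ e))))))) : ¬ T.Tw Q (c i) (c j) := by
  intro hh
  have := hh (c k) hQ (fun hc => hki (h.inj _ _ hk hi hc)) (fun hc => hkj (h.inj _ _ hk hj hc))
  rw [h.full hk hi, h.full hk hj] at this
  exact hne e this

theorem IsTU.notprime {H S : Set V} {e : Prop} {m : ℕ} {c : ℕ → V} (h : T.IsTU H S e m c)
    (h5 : 5 ≤ S.ncard) (hm : 7 ≤ m) {z : V} (hz : z ∉ S)
    (hno : ∀ a b, T.Ed H S a b → ¬ T.PrimeOn (insert z (S \ {a, b}))) :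
    ¬ T.PrimeOn (insert z S) := by
  have hodd := h.odd
  have ms : ∀ i, i < m → c i ∈ S := fun i hi => (h.mem _).2 ⟨i, hi, rfl⟩
  have ne : ∀ {i j}, i < m → j < m → i ≠ j → c i ≠ c j := fun hi hj hij hh => hij (h.inj _ _ hi hj hh)
  have tw : ∀ i x j, i < m → x < m → j < m → (∀ k, k < m → k ≠ x → k ≠ i → k ≠ j → ∀ e : Prop,
      ((((k < i ∧ (k % 2 ≠ i % 2 ∨ (k % 2 = 1 ∧ e))) ∨
        (i < k ∧ ¬ (i % 2 ≠ k % 2 ∨ (i % 2 = 1 ∧ e))))) ↔ (((k < j ∧ (k % 2 ≠ j % 2 ∨ (k % 2 = 1 ∧ e))) ∨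
        (j < k ∧ ¬ (j % 2 ≠ k % 2 ∨ (j % 2 = 1 ∧ e))))))) → T.Tw (S \ {c x}) (c i) (c j) := by
    intro i x j hi hx hj hh y hy h1 h2
    obtain ⟨k, hk, rfl⟩ := (h.mem y).1 hy.1
    rw [h.full hk hi, h.full hk hj]
    exact hh k hk (fun hc => hy.2 (by rw [hc]; rfl)) (fun hc => h1 (by rw [hc]))
      (fun hc => h2 (by rw [hc])) e
  let P : Set V := {y | ∃ i, i < m ∧ i ≠ 1 ∧ i ≠ 2 ∧ i ≠ 4 ∧ i ≠ 5 ∧ c i = y}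
  have mP : ∀ i, i < m → i ≠ 1 → i ≠ 2 → i ≠ 4 → i ≠ 5 → c i ∈ P :=
    fun i h1 h2 h3 h4 h5 => ⟨i, h1, h2, h3, h4, h5, rfl⟩
  have ntw : ∀ i j, i < j → j < m → c i ∈ P → c j ∈ P → i ≠ 1 → i ≠ 2 → i ≠ 4 → i ≠ 5 →
      j ≠ 1 → j ≠ 2 → j ≠ 4 → j ≠ 5 → ¬ T.Tw P (c i) (c j) := by
    intro i j hij hj _ _ i1 i2 i4 i5 j1 j2 j4 j5
    by_cases hp : i % 2 = j % 2
    · rcases (by omega : i = 0 ∨ i = 3 ∨ 6 ≤ i) with rfl | rfl | h6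
      · exact h.ntw 3 (by omega) hj (by omega) (mP 3 (by omega) (by omega) (by omega) (by omega)
          (by omega)) (by omega) (by omega) (by intro e; by_cases he : e <;> simp only [he, and_true, true_and, and_false, false_and, or_true, true_or, or_false, false_or, not_true_eq_false, not_false_eq_true, ne_eq, iff_true, true_iff, iff_false, false_iff] <;> omega)
      · exact h.ntw 6 (by omega) hj (by omega) (mP 6 (by omega) (by omega) (by omega) (by omega)
          (by omega)) (by omega) (by omega) (by intro e; by_cases he : e <;> simp only [he, and_true, true_and, and_false, false_and, or_true, true_or, or_false, false_or, not_true_eq_false, not_false_eq_true, ne_eq, iff_true, true_iff, iff_false, false_iff] <;> omega)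
      · exact h.ntw (i+1) (by omega) hj (by omega) (mP (i+1) (by omega) (by omega) (by omega)
          (by omega) (by omega)) (by omega) (by omega)
          (by intro e; by_cases he : e <;> simp only [he, and_true, true_and, and_false, false_and, or_true, true_or, or_false, false_or, not_true_eq_false, not_false_eq_true, ne_eq, iff_true, true_iff, iff_false, false_iff] <;> omega)
    · by_cases hi0 : i % 2 = 0
      · exact h.ntw (m-1) (by omega) hj (by omega) (mP (m-1) (by omega) (by omega) (by omega)
          (by omega) (by omega)) (by omega) (by omega)
          (by intro e; by_cases he : e <;> simp only [he, and_true, true_and, and_false, false_and, or_true, true_or, or_false, false_or, not_true_eq_false, not_false_eq_true, ne_eq, iff_true, true_iff, iff_false, false_iff] <;> omega)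
      · exact h.ntw 0 (by omega) hj (by omega) (mP 0 (by omega) (by omega) (by omega)
          (by omega) (by omega)) (by omega) (by omega)
          (by intro e; by_cases he : e <;> simp only [he, and_true, true_and, and_false, false_and, or_true, true_or, or_false, false_or, not_true_eq_false, not_false_eq_true, ne_eq, iff_true, true_iff, iff_false, false_iff] <;> omega)
  have nz : ∀ i p q, i < m → p < m → q < m → c p ∈ P → c q ∈ P → p ≠ i → q ≠ i →
      T.rel (c i) (c p) → T.rel (c q) (c i) → ¬ T.Zs P (c i) := by
    intro i p q hi hp hq mp mq pi qi r1 r2 hh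
    rcases hh with hh | hh
    · exact T.asymm _ _ r2 (hh _ mq (ne hq hi qi))
    · exact T.asymm _ _ r1 (hh _ mp (ne hp hi pi))
  have rr : ∀ i j, i < j → j < m → i % 2 ≠ j % 2 → T.rel (c i) (c j) :=
    fun i j h1 h2 h3 => (h.rel i j h1 h2).2 (Or.inl h3)
  have rb : ∀ i j, i < j → j < m → i % 2 = 0 → j % 2 = 0 → T.rel (c j) (c i) := by
    intro i j h1 h2 h3 h4
    rw [h.full h2 (by omega)]; right
    exact ⟨h1, by omega⟩
  have key := ext_lemma (T := T) (S := S) (a := c 1) (b := c 2) (c := c 4) (d := c 5) (z := z) (P := P)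
    (ms _ (by omega)) (ms _ (by omega)) (ms _ (by omega)) (ms _ (by omega))
    (ne (by omega) (by omega) (by omega)) (ne (by omega) (by omega) (by omega))
    (ne (by omega) (by omega) (by omega)) (ne (by omega) (by omega) (by omega)) hz
    (by
      intro y
      constructor
      · rintro ⟨i, hi, h1, h2, h3, h4, rfl⟩
        exact ⟨ms i hi, ne hi (by omega) h1, ne hi (by omega) h2, ne hi (by omega) h3,
          ne hi (by omega) h4⟩
      · rintro ⟨hy, h1, h2, h3, h4⟩
        obtain ⟨k, hk, rfl⟩ := (h.mem y).1 hy
        exact ⟨k, hk, fun hh => h1 (by rw [hh]), fun hh => h2 (by rw [hh]),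
          fun hh => h3 (by rw [hh]), fun hh => h4 (by rw [hh]), rfl⟩)
    ⟨c 0, mP 0 (by omega) (by omega) (by omega) (by omega) (by omega)⟩
    (by
      rintro _ ⟨i, hi, h1, h2, h3, h4, rfl⟩ _ ⟨j, hj, g1, g2, g3, g4, rfl⟩ hne
      rcases lt_trichotomy i j with hl | rfl | hl
      · exact ntw i j hl hj (mP i hi h1 h2 h3 h4) (mP j hj g1 g2 g3 g4) h1 h2 h3 h4 g1 g2 g3 g4
      · exact absurd rfl hne
      · exact fun hh => ntw j i hl hi (mP j hj g1 g2 g3 g4) (mP i hi h1 h2 h3 h4)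
          g1 g2 g3 g4 h1 h2 h3 h4 hh.symm)
    (by
      rintro _ ⟨i, hi, h1, h2, h3, h4, rfl⟩
      have q0 := mP 0 (by omega) (by omega) (by omega) (by omega) (by omega)
      have q3 := mP 3 (by omega) (by omega) (by omega) (by omega) (by omega)
      have ql := mP (m-1) (by omega) (by omega) (by omega) (by omega) (by omega)
      by_cases hp : i % 2 = 1
      · exact nz i (m-1) 0 hi (by omega) (by omega) ql q0 (by omega) (by omega)
          (rr _ _ (by omega) (by omega) (by omega)) (rr _ _ (by omega) (by omega) (by omega))
      · by_cases i0 : i = 0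
        · subst i0
          exact nz 0 3 (m-1) hi (by omega) (by omega) q3 ql (by omega) (by omega)
            (rr _ _ (by omega) (by omega) (by omega)) (rb _ _ (by omega) (by omega) (by omega) (by omega))
        · exact nz i 0 3 hi (by omega) (by omega) q0 q3 (by omega) (by omega)
            (rb _ _ (by omega) (by omega) (by omega) (by omega)) (rr _ _ (by omega) (by omega) (by omega)))
    (Or.inl ⟨c 3, mP 3 (by omega) (by omega) (by omega) (by omega) (by omega),
      tw _ _ _ (by omega) (by omega) (by omega)
        (by intro k hk k1 k2 k3 e; by_cases he : e <;> simp only [he, and_true, true_and, and_false, false_and, or_true, true_or, or_false, false_or, not_true_eq_false, not_false_eq_true, ne_eq, iff_true, true_iff, iff_false, false_iff] <;> omega)⟩)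
    (Or.inl ⟨c 0, mP 0 (by omega) (by omega) (by omega) (by omega) (by omega),
      tw _ _ _ (by omega) (by omega) (by omega)
        (by intro k hk k1 k2 k3 e; by_cases he : e <;> simp only [he, and_true, true_and, and_false, false_and, or_true, true_or, or_false, false_or, not_true_eq_false, not_false_eq_true, ne_eq, iff_true, true_iff, iff_false, false_iff] <;> omega)⟩)
    (Or.inl ⟨c 6, mP 6 (by omega) (by omega) (by omega) (by omega) (by omega),
      tw _ _ _ (by omega) (by omega) (by omega)
        (by intro k hk k1 k2 k3 e; by_cases he : e <;> simp only [he, and_true, true_and, and_false, false_and, or_true, true_or, or_false, false_or, not_true_eq_false, not_false_eq_true, ne_eq, iff_true, true_iff, iff_false, false_iff] <;> omega)⟩)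
    (Or.inl ⟨c 3, mP 3 (by omega) (by omega) (by omega) (by omega) (by omega),
      tw _ _ _ (by omega) (by omega) (by omega)
        (by intro k hk k1 k2 k3 e; by_cases he : e <;> simp only [he, and_true, true_and, and_false, false_and, or_true, true_or, or_false, false_or, not_true_eq_false, not_false_eq_true, ne_eq, iff_true, true_iff, iff_false, false_iff] <;> omega)⟩)
    (h.ntw 0 (by omega) (by omega) (by omega) (mP 0 (by omega) (by omega) (by omega) (by omega)
      (by omega)) (by omega) (by omega) (by intro e; by_cases he : e <;> simp only [he, and_true, true_and, and_false, false_and, or_true, true_or, or_false, false_or, not_true_eq_false, not_false_eq_true, ne_eq, iff_true, true_iff, iff_false, false_iff] <;> omega))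
    (h.ntw 3 (by omega) (by omega) (by omega) (mP 3 (by omega) (by omega) (by omega) (by omega)
      (by omega)) (by omega) (by omega) (by intro e; by_cases he : e <;> simp only [he, and_true, true_and, and_false, false_and, or_true, true_or, or_false, false_or, not_true_eq_false, not_false_eq_true, ne_eq, iff_true, true_iff, iff_false, false_iff] <;> omega))
    (h.ntw 3 (by omega) (by omega) (by omega) (mP 3 (by omega) (by omega) (by omega) (by omega)
      (by omega)) (by omega) (by omega) (by intro e; by_cases he : e <;> simp only [he, and_true, true_and, and_false, false_and, or_true, true_or, or_false, false_or, not_true_eq_false, not_false_eq_true, ne_eq, iff_true, true_iff, iff_false, false_iff] <;> omega))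
    (h.ntw 6 (by omega) (by omega) (by omega) (mP 6 (by omega) (by omega) (by omega) (by omega)
      (by omega)) (by omega) (by omega) (by intro e; by_cases he : e <;> simp only [he, and_true, true_and, and_false, false_and, or_true, true_or, or_false, false_or, not_true_eq_false, not_false_eq_true, ne_eq, iff_true, true_iff, iff_false, false_iff] <;> omega))
    (ed_type hz (h.ed 1 (by omega)) (hno _ _ (h.ed 1 (by omega))))
    (ed_type hz (h.ed 4 (by omega)) (hno _ _ (h.ed 4 (by omega))))
  exact not_prime_insert h5 hz key

theorem IsW.notprime {H S : Set V} {w : V} {m : ℕ} {c : ℕ → V} (h : T.IsW H S w m c)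
    (h5 : 5 ≤ S.ncard) (hm : 6 ≤ m) {z : V} (hz : z ∉ S)
    (hno : ∀ a b, T.Ed H S a b → ¬ T.PrimeOn (insert z (S \ {a, b}))) :
    ¬ T.PrimeOn (insert z S) := by
  have heven := h.even
  have ms : ∀ i, i < m → c i ∈ S := fun i hi => (h.mem _).2 (Or.inr ⟨i, hi, rfl⟩)
  have mw : w ∈ S := (h.mem _).2 (Or.inl rfl)
  have ne : ∀ {i j}, i < m → j < m → i ≠ j → c i ≠ c j := fun hi hj hij hh => hij (h.inj _ _ hi hj hh)
  have full : ∀ {i j}, i < m → j < m → (T.rel (c i) (c j) ↔ i < j) := by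
    intro i j hi hj
    constructor
    · intro hh
      by_contra hl
      rcases (by omega : i = j ∨ j < i) with rfl | hl
      · exact T.asymm _ _ hh hh
      · exact T.asymm _ _ hh (h.rel _ _ hl hi)
    · intro hl; exact h.rel _ _ hl hj
  have relw' : ∀ {i}, i < m → (T.rel w (c i) ↔ i % 2 = 0) := by
    intro i hi
    rw [rel_iff (h.new i hi).symm, h.relw i hi]; omega
  have tw : ∀ i x j, i < m → x < m → j < m → i % 2 = j % 2 →
      (∀ k, k < m → k ≠ x → k ≠ i → k ≠ j → (k < i ↔ k < j)) → T.Tw (S \ {c x}) (c i) (c j) := by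
    intro i x j hi hx hj hp hh y hy h1 h2
    rcases (h.mem y).1 hy.1 with rfl | ⟨k, hk, rfl⟩
    · rw [relw' hi, relw' hj, hp]
    · rw [full hk hi, full hk hj]
      exact hh k hk (fun hc => hy.2 (by rw [hc]; rfl)) (fun hc => h1 (by rw [hc]))
        (fun hc => h2 (by rw [hc]))
  let P : Set V := {y | y = w ∨ ∃ i, i < m ∧ i ≠ 0 ∧ i ≠ 1 ∧ i ≠ 3 ∧ i ≠ 4 ∧ c i = y}
  have wP : w ∈ P := Or.inl rfl
  have mP : ∀ i, i < m → i ≠ 0 → i ≠ 1 → i ≠ 3 → i ≠ 4 → c i ∈ P :=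
    fun i h1 h2 h3 h4 h5 => Or.inr ⟨i, h1, h2, h3, h4, h5, rfl⟩
  have q2 : c 2 ∈ P := mP 2 (by omega) (by omega) (by omega) (by omega) (by omega)
  have q5 : c 5 ∈ P := mP 5 (by omega) (by omega) (by omega) (by omega) (by omega)
  have ql : c (m-1) ∈ P := mP (m-1) (by omega) (by omega) (by omega) (by omega) (by omega)
  have ntk : ∀ i j k, i < m → j < m → k < m → c k ∈ P → k ≠ i → k ≠ j → ¬ (k < i ↔ k < j) →
      ¬ T.Tw P (c i) (c j) := by
    intro i j k hi hj hk mk ki kj hne hh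
    have := hh _ mk (ne hk hi ki) (ne hk hj kj)
    rw [full hk hi, full hk hj] at this
    exact hne this
  have ntp : ∀ i j, i < m → j < m → i % 2 ≠ j % 2 → ¬ T.Tw P (c i) (c j) := by
    intro i j hi hj hp hh
    have := hh _ wP (h.new i hi).symm (h.new j hj).symm
    rw [relw' hi, relw' hj] at this
    omega
  have ntw : ∀ i, i < m → i ≠ 0 → i ≠ 1 → i ≠ 3 → i ≠ 4 → ¬ T.Tw P (c i) w := by
    intro i hi i0 i1 i3 i4 hh
    by_cases hp : i % 2 = 0
    · have := hh _ ql (ne (by omega) hi (by omega)) (h.new _ (by omega))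
      rw [full (by omega) hi, h.relw _ (by omega)] at this
      omega
    · have := hh _ q2 (ne (by omega) hi (by omega)) (h.new _ (by omega))
      rw [full (by omega) hi, h.relw _ (by omega)] at this
      omega
  have ntc : ∀ i j, i < j → j < m → i ≠ 0 → i ≠ 1 → i ≠ 3 → i ≠ 4 → j ≠ 4 →
      ¬ T.Tw P (c i) (c j) := by
    intro i j hij hj i0 i1 i3 i4 j4
    by_cases hp : i % 2 = j % 2
    · by_cases i2 : i = 2
      · exact ntk i j 5 (by omega) hj (by omega) q5 (by omega) (by omega) (by omega)
      · exact ntk i j (i+1) (by omega) hj (by omega)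
          (mP _ (by omega) (by omega) (by omega) (by omega) (by omega))
          (by omega) (by omega) (by omega)
    · exact ntp i j (by omega) hj hp
  have nz : ∀ x p q, p ∈ P → q ∈ P → p ≠ x → q ≠ x →
      T.rel x p → T.rel q x → ¬ T.Zs P x := by
    intro x p q mp mq pi qi r1 r2 hh
    rcases hh with hh | hh
    · exact T.asymm _ _ r2 (hh _ mq qi)
    · exact T.asymm _ _ r1 (hh _ mp pi)
  have key := ext_lemma (T := T) (S := S) (a := c 0) (b := c 1) (c := c 3) (d := c 4) (z := z) (P := P)
    (ms _ (by omega)) (ms _ (by omega)) (ms _ (by omega)) (ms _ (by omega))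
    (ne (by omega) (by omega) (by omega)) (ne (by omega) (by omega) (by omega))
    (ne (by omega) (by omega) (by omega)) (ne (by omega) (by omega) (by omega)) hz
    (by
      intro y
      constructor
      · rintro (rfl | ⟨i, hi, h1, h2, h3, h4, rfl⟩)
        · exact ⟨mw, (h.new _ (by omega)).symm, (h.new _ (by omega)).symm,
            (h.new _ (by omega)).symm, (h.new _ (by omega)).symm⟩
        · exact ⟨ms i hi, ne hi (by omega) h1, ne hi (by omega) h2, ne hi (by omega) h3,
            ne hi (by omega) h4⟩
      · rintro ⟨hy, h1, h2, h3, h4⟩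
        rcases (h.mem y).1 hy with rfl | ⟨k, hk, rfl⟩
        · exact wP
        · exact Or.inr ⟨k, hk, fun hh => h1 (by rw [hh]), fun hh => h2 (by rw [hh]),
            fun hh => h3 (by rw [hh]), fun hh => h4 (by rw [hh]), rfl⟩)
    ⟨w, wP⟩
    (by
      rintro _ (rfl | ⟨i, hi, h1, h2, h3, h4, rfl⟩) _ (rfl | ⟨j, hj, g1, g2, g3, g4, rfl⟩) hne
      · exact absurd rfl hne
      · exact fun hh => ntw j hj g1 g2 g3 g4 hh.symm
      · exact ntw i hi h1 h2 h3 h4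
      · rcases lt_trichotomy i j with hl | rfl | hl
        · exact ntc i j hl hj h1 h2 h3 h4 g4
        · exact absurd rfl hne
        · exact fun hh => ntc j i hl hi g1 g2 g3 g4 h4 hh.symm)
    (by
      rintro _ (rfl | ⟨i, hi, h1, h2, h3, h4, rfl⟩)
      · exact nz _ _ _ q2 q5 (h.new _ (by omega)) (h.new _ (by omega)) ((relw' (by omega)).2 (by omega))
          ((h.relw _ (by omega)).2 (by omega))
      · by_cases hp : i % 2 = 0
        · exact nz _ _ _ ql wP (ne (by omega) hi (by omega)) (h.new i hi).symm
            (h.rel _ _ (by omega) (by omega)) ((relw' hi).2 hp)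
        · exact nz _ _ _ wP q2 (h.new i hi).symm (ne (by omega) hi (by omega))
            ((h.relw i hi).2 (by omega)) (h.rel _ _ (by omega) (by omega)))
    (Or.inl ⟨c 2, q2, tw _ _ _ (by omega) (by omega) (by omega) (by omega) (by omega)⟩)
    (Or.inr (by
      left
      intro y hy h1
      rcases (h.mem y).1 hy.1 with rfl | ⟨k, hk, rfl⟩
      · exact (h.relw _ (by omega)).2 (by omega)
      · refine h.rel _ _ ?_ hk
        have k0 : k ≠ 0 := fun hc => hy.2 (by rw [hc]; rfl)
        have k1 : k ≠ 1 := fun hc => h1 (by rw [hc])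
        omega))
    (Or.inl ⟨c 5, q5, tw _ _ _ (by omega) (by omega) (by omega) (by omega) (by omega)⟩)
    (Or.inl ⟨c 2, q2, tw _ _ _ (by omega) (by omega) (by omega) (by omega) (by omega)⟩)
    (ntp _ _ (by omega) (by omega) (by omega))
    (ntk _ _ 2 (by omega) (by omega) (by omega) q2 (by omega) (by omega) (by omega))
    (ntk _ _ 2 (by omega) (by omega) (by omega) q2 (by omega) (by omega) (by omega))
    (ntp _ _ (by omega) (by omega) (by omega))
    (ed_type hz (h.ed 0 (by omega)) (hno _ _ (h.ed 0 (by omega))))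
    (ed_type hz (h.ed 3 (by omega)) (hno _ _ (h.ed 3 (by omega))))
  exact not_prime_insert h5 hz key

theorem IsTU.card {H S : Set V} {e : Prop} {m : ℕ} {c : ℕ → V} (h : T.IsTU H S e m c) :
    S.ncard = m := by
  have : S = c '' (Set.Iio m) := by
    ext v; rw [h.mem]; simp
  have hinj : Set.InjOn c (Set.Iio m) := fun i hi j hj hij => h.inj i j hi hj hij
  rw [this, hinj.ncard_image]
  simp [Set.ncard_eq_toFinset_card']

theorem IsW.card {H S : Set V} {w : V} {m : ℕ} {c : ℕ → V} (h : T.IsW H S w m c) :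
    S.ncard = m + 1 := by
  have : S = insert w (c '' (Set.Iio m)) := by
    ext v; rw [h.mem]; simp
  have hinj : Set.InjOn c (Set.Iio m) := fun i hi j hj hij => h.inj i j hi hj hij
  rw [this, Set.ncard_insert_of_notMem, hinj.ncard_image]
  · simp [Set.ncard_eq_toFinset_card']
  · rintro ⟨i, hi, hh⟩; exact h.new i hi hh

/-- The position in the chain of the `i`-th vertex of `T_m` or `U_m`. -/
def pos (m i : ℕ) : ℕ := if i < m / 2 then 2 * (m / 2 - 1 - i) + 1 else 2 * (m - 1 - i)

theorem TT_iff {m : ℕ} (i j : Fin m) : TTrel m i j ↔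
    ((i.val < j.val ∧ j.val - i.val ≤ m / 2) ∨ (j.val < i.val ∧ j.val + m - i.val ≤ m / 2)) := by
  have hi := i.2
  have hj := j.2
  unfold TTrel
  rcases le_or_gt i.val j.val with hl | hl
  · have : (j.val + m - i.val) % m = j.val - i.val := by
      rw [show j.val + m - i.val = (j.val - i.val) + m by omega, Nat.add_mod_right,
        Nat.mod_eq_of_lt (by omega)]
    rw [this]; omega
  · have : (j.val + m - i.val) % m = j.val + m - i.val := Nat.mod_eq_of_lt (by omega)
    rw [this]; omega

theorem IsTU.iso {H S : Set V} {e : Prop} {m : ℕ} {c : ℕ → V} (h : T.IsTU H S e m c) :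
    T.IsoOnFin S (TTrel m) ∨ T.IsoOnFin S (UUrel m) := by
  have hodd := h.odd
  have lt : ∀ i : Fin m, pos m i < m := by
    intro i; have := i.2; unfold pos; split <;> omega
  have inj : Function.Injective (fun i : Fin m => c (pos m i)) := by
    intro i j hij
    have := h.inj _ _ (lt i) (lt j) hij
    have h1 := i.2
    have h2 := j.2
    apply Fin.ext
    unfold pos at this
    split at this <;> split at this <;> omega
  have rng : Set.range (fun i : Fin m => c (pos m i)) = S := by
    ext v
    rw [h.mem]
    constructor
    · rintro ⟨i, rfl⟩; exact ⟨_, lt i, rfl⟩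
    · rintro ⟨k, hk, rfl⟩
      by_cases hp : k % 2 = 1
      · refine ⟨⟨m / 2 - 1 - k / 2, by omega⟩, ?_⟩
        simp only
        congr 1
        unfold pos; split <;> omega
      · refine ⟨⟨m - 1 - k / 2, by omega⟩, ?_⟩
        simp only
        congr 1
        unfold pos; split <;> omega
  by_cases he : e
  · right
    refine ⟨_, inj, rng, ?_⟩
    intro i j
    rw [h.full (lt i) (lt j)]
    have h1 := i.2
    have h2 := j.2
    unfold UUrel
    simp only [he, and_true]
    split
    · rw [TT_iff]; unfold pos; split <;> split <;> omega
    · rw [TT_iff]; unfold pos; split <;> split <;> omega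
  · left
    refine ⟨_, inj, rng, ?_⟩
    intro i j
    rw [h.full (lt i) (lt j)]
    have h1 := i.2
    have h2 := j.2
    simp only [he, and_false, or_false]
    rw [TT_iff]; unfold pos; split <;> split <;> omega

theorem IsW.iso {H S : Set V} {w : V} {m : ℕ} {c : ℕ → V} (h : T.IsW H S w m c) :
    T.IsoOnFin S (WWrel (m + 1)) := by
  refine ⟨fun i => if i.val < m then c i.val else w, ?_, ?_, ?_⟩
  · intro i j hij
    have h1 := i.2
    have h2 := j.2
    apply Fin.ext
    by_cases hi : i.val < m <;> by_cases hj : j.val < m <;> simp only [hi, hj, if_true, if_false] at hij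
    · exact h.inj _ _ hi hj hij
    · exact absurd hij (h.new _ hi)
    · exact absurd hij.symm (h.new _ hj)
    · omega
  · ext v
    rw [h.mem]
    constructor
    · rintro ⟨i, rfl⟩
      by_cases hi : i.val < m
      · right; exact ⟨_, hi, by simp [hi]⟩
      · left; simp [hi]
    · rintro (rfl | ⟨k, hk, rfl⟩)
      · exact ⟨⟨m, by omega⟩, by simp⟩
      · exact ⟨⟨k, by omega⟩, by simp [hk]⟩
  · intro i j
    have h1 := i.2
    have h2 := j.2
    unfold WWrel
    by_cases hi : i.val < m <;> by_cases hj : j.val < m <;> simp only [hi, hj, if_true, if_false]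
    · have : T.rel (c i.val) (c j.val) ↔ i.val < j.val := by
        constructor
        · intro hh
          by_contra hl
          rcases (by omega : i.val = j.val ∨ j.val < i.val) with he | hl
          · rw [he] at hh; exact T.asymm _ _ hh hh
          · exact T.asymm _ _ hh (h.rel _ _ hl hi)
        · intro hl; exact h.rel _ _ hl hj
      rw [this]; omega
    · rw [h.relw _ hi]; omega
    · rw [rel_iff (h.new _ hj).symm, h.relw _ hj]; omega
    · have : ¬ T.rel w w := fun hh => T.asymm _ _ hh hh
      simp only [this, iff_false]; omega

theorem max_step {H R : Set V} (hH : T.PrimeOn H) (h5 : 5 ≤ H.ncard) (hR : T.QQ H R)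
    (hlt : H.ncard < R.ncard) : ∃ A, T.QQ H A ∧ ((∃ v, v ∉ A ∧ R = insert v A) ∨
      ∃ v y, v ∉ A ∧ y ∉ A ∧ y ≠ v ∧ R = insert y (insert v A)) := by
  have hne : {A | T.QQ H A ∧ A ⊆ R ∧ A ≠ R}.Nonempty := by
    obtain ⟨hRp, f, f1, f2, f3⟩ := hR
    refine ⟨f '' H, ⟨prime_image hH f3, f, f1, fun v hv => ⟨v, hv, rfl⟩, f3⟩, ?_, ?_⟩
    · rintro _ ⟨v, hv, rfl⟩; exact f2 v hv
    · intro hh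
      have := f1.ncard_image
      rw [hh] at this
      omega
  obtain ⟨A, ⟨hA, hAR, hAne⟩, hmax⟩ := Set.exists_max_image _ Set.ncard (Set.toFinite _) hne
  have hcard := hA.card
  have up : ∀ X, A ⊆ X → X ⊆ R → T.PrimeOn X → A.ncard < X.ncard → X = R := by
    intro X h1 h2 h3 h4
    by_contra h6
    have := hmax X ⟨hA.up h1 h3, h2, h6⟩
    omega
  refine ⟨A, hA, ?_⟩
  rcases grow_step hA.1 (by omega) hR.1 hAR hAne with ⟨v, hv, hvA, hp⟩ | ⟨v, hv, y, hy, hvA, hyA, hyv, hp⟩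
  · left
    refine ⟨v, hvA, (up _ (Set.subset_insert _ _) (Set.insert_subset hv hAR) hp ?_).symm⟩
    rw [Set.ncard_insert_of_notMem hvA]; omega
  · right
    refine ⟨v, y, hvA, hyA, hyv, (up _ ((Set.subset_insert _ _).trans (Set.subset_insert _ _))
      (Set.insert_subset hy (Set.insert_subset hv hAR)) hp ?_).symm⟩
    rw [Set.ncard_insert_of_notMem (by simp [hyA, hyv]), Set.ncard_insert_of_notMem hvA]; omega

theorem structure_lemma {H A : Set V} (hH : T.PrimeOn H) (h5 : 5 ≤ H.ncard) (hA : T.QQ H A)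
    (hlt : H.ncard < A.ncard) (hev : A.ncard % 2 = H.ncard % 2)
    (hodd : ∀ C, T.QQ H C → C.ncard < A.ncard → C.ncard % 2 = H.ncard % 2) :
    ∃ m c, (∃ e, T.IsTU H A e m c) ∨ ∃ w, T.IsW H A w m c := by
  obtain ⟨B, hB, ⟨v, hv, rfl⟩ | ⟨v, y, hv, hy, hyv, rfl⟩⟩ := max_step hH h5 hA hlt
  · exfalso
    rw [Set.ncard_insert_of_notMem hv] at hev hodd
    have := hodd B hB (by omega)
    omega
  · have hab : T.Ed H (insert y (insert v B)) y v := by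
      refine ⟨by simp, by simp, hyv, ?_⟩
      have : insert y (insert v B) \ {y, v} = B := by
        ext t
        simp only [Set.mem_sdiff, Set.mem_insert_iff, Set.mem_singleton_iff]
        constructor
        · rintro ⟨h1 | h1 | h1, h2⟩
          · exact absurd (Or.inl h1) h2
          · exact absurd (Or.inr h1) h2
          · exact h1
        · intro h
          refine ⟨Or.inr (Or.inr h), ?_⟩
          rintro (rfl | rfl)
          · exact hy h
          · exact hv h
      rw [this]; exact hB
    obtain ⟨m, c, hc⟩ := exists_chain (by omega) hA.1 (fun t ht hq => by
      have h1 := Set.ncard_sdiff_singleton_add_one ht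
      have := hodd _ hq (by omega)
      omega) hab
    exact ⟨m, c, hc.classify (by omega) hA.1⟩

theorem main_grow {H : Set V} (hG : T.PrimeOn Set.univ) (hH : T.PrimeOn H) (h5 : 5 ≤ H.ncard)
    (hle : H.ncard < (Set.univ : Set V).ncard)
    (hno : ∀ S, T.QQ H S → S.ncard ≠ H.ncard + 1) :
    ∃ m c, (∃ e, T.IsTU H Set.univ e m c) ∨ ∃ w, T.IsW H Set.univ w m c := by
  have hU : T.QQ H Set.univ := ⟨hG, (Emb.refl H).mono (Set.subset_univ _)⟩
  have heven : ∀ C, T.QQ H C → C.ncard % 2 = H.ncard % 2 := by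
    by_contra! hex
    obtain ⟨R, ⟨hR, hRo⟩, hmin⟩ := Set.exists_min_image {C | T.QQ H C ∧ C.ncard % 2 ≠ H.ncard % 2}
      Set.ncard (Set.toFinite _) hex
    have hRc := hR.card
    have hsm : ∀ C, T.QQ H C → C.ncard < R.ncard → C.ncard % 2 = H.ncard % 2 := by
      intro C hC hCR
      by_contra hh
      have := hmin C ⟨hC, hh⟩
      omega
    obtain ⟨A, hA, ⟨v, hv, rfl⟩ | ⟨v, y, hv, hy, hyv, rfl⟩⟩ := max_step hH h5 hR (by
      rcases hRc.lt_or_eq with h | h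
      · exact h
      · rw [h] at hRo; exact absurd rfl hRo)
    · have hAc := hA.card
      have hn := hno _ hR
      rw [Set.ncard_insert_of_notMem hv] at hsm hRo hn
      have hAe := hsm A hA (by omega)
      have hped : ∀ a b, T.Ed H A a b → ¬ T.PrimeOn (insert v (A \ {a, b})) := by
        intro a b hab hp
        have h1 := hab.card
        have h2 := hab.2.2.2.up (Set.subset_insert v _) hp
        have h3 : (insert v (A \ {a, b})).ncard = (A \ {a, b}).ncard + 1 :=
          Set.ncard_insert_of_notMem (fun h => hv h.1)
        have := hsm _ h2 (by omega)
        omega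
      obtain ⟨m, c, ⟨e, h⟩ | ⟨w, h⟩⟩ := structure_lemma hH h5 hA (by omega) hAe
        (fun C hC hl => hsm C hC (by omega))
      · have := h.card
        exact h.notprime (by omega) (by omega) hv hped hR.1
      · have := h.card
        exact h.notprime (by omega) (by omega) hv hped hR.1
    · rw [Set.ncard_insert_of_notMem (by simp [hy, hyv]), Set.ncard_insert_of_notMem hv] at hsm hRo
      have := hsm A hA (by omega)
      omega
  exact structure_lemma hH h5 hU hle (heven _ hU) (fun C hC _ => heven C hC)
end Grow
end Tournament
/-- Growing prime tournaments one vertex at a time: if the prime tournament `G` is not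
`T_n`, `U_n` or `W_n` for any odd `n`, and `H` is a prime subtournament with
`5 ≤ |V(H)| ≤ |V(G)| - 1`, then `G` has a prime subtournament with `|V(H)| + 1` vertices
containing a subtournament isomorphic to `H`. -/
theorem stmt2 {V : Type} [Fintype V] (T : Tournament V)
    (hG : T.PrimeOn Set.univ)
    (hnotT : ¬ ∃ n : ℕ, Odd n ∧ T.IsoOnFin Set.univ (TTrel n))
    (hnotU : ¬ ∃ n : ℕ, Odd n ∧ T.IsoOnFin Set.univ (UUrel n))
    (hnotW : ¬ ∃ n : ℕ, Odd n ∧ T.IsoOnFin Set.univ (WWrel n))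
    (H : Set V) (hH : T.PrimeOn H)
    (h5 : 5 ≤ H.ncard) (hle : H.ncard ≤ Nat.card V - 1) :
    ∃ S : Set V, T.PrimeOn S ∧ S.ncard = H.ncard + 1 ∧
      ∃ f : V → V, Set.InjOn f H ∧ (∀ v ∈ H, f v ∈ S) ∧
        ∀ u ∈ H, ∀ v ∈ H, (T.rel u v ↔ T.rel (f u) (f v)) := by
  by_contra hcon
  have hno : ∀ S, T.QQ H S → S.ncard ≠ H.ncard + 1 := fun S hS hc => hcon ⟨S, hS.1, hc, hS.2⟩
  have hlt : H.ncard < (Set.univ : Set V).ncard := by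
    rw [Set.ncard_univ]; omega
  obtain ⟨m, c, ⟨e, h⟩ | ⟨w, h⟩⟩ := Tournament.main_grow hG hH h5 hlt hno
  · have hm : Odd m := Nat.odd_iff.2 h.odd
    rcases h.iso with hi | hi
    · exact hnotT ⟨m, hm, hi⟩
    · exact hnotU ⟨m, hm, hi⟩
  · exact hnotW ⟨m + 1, by rw [Nat.odd_iff]; have := h.even; omega, h.iso⟩
end

section
/- Let G be a prime tournament and let u ∈ V(G). Let H_1, H_2 be prime subtournaments of G such that V(H_1) ∪ V(H_2) = V(G)∖{u}, both H_1+u and H_2+u are decomposable, and the subtournament H_{1,2} induced on V(H_1) ∩ V(H_2) is prime with |V(H_{1,2})| ≥ 3. Then either u ∈ V_x(H_1) for some x ∈ V(H_1)∖V(H_2), or u ∈ V_y(H_2) for some y ∈ V(H_2)∖V(H_1). -/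
theorem aux_decomp {V : Type} [Fintype V] (T : Tournament V) (u : V) (H : Set V)
    (hu : u ∉ H) (hp : T.PrimeOn H) (hd : ¬ T.PrimeOn (insert u H)) :
    ((∀ x ∈ H, T.rel u x) ∨ (∀ x ∈ H, T.rel x u)) ∨ ∃ x ∈ H, T.mem_Vx H x u := by
  have : ∃ X : Set V, T.HomogOn (insert u H) X ∧ ¬ (X.ncard ≤ 1 ∨ X = insert u H) := by
    by_contra hcon
    push Not at hcon
    refine hd ⟨⟨u, by simp⟩, fun X hX => ?_⟩
    have := hcon X hX
    tauto
  obtain ⟨X, ⟨hXs, hX⟩, hn⟩ := this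
  push Not at hn
  obtain ⟨hn1, hn2⟩ := hn
  have hh : T.HomogOn H (X ∩ H) := by
    refine ⟨Set.inter_subset_right, fun v hv => ?_⟩
    rcases hX v ⟨Or.inr hv.1, fun h => hv.2 ⟨h, hv.1⟩⟩ with h | h
    · exact Or.inl fun x hx => h x hx.1
    · exact Or.inr fun x hx => h x hx.1
  rcases hp.2 _ hh with h | h
  · right
    obtain ⟨a, ha, b, hb, hab⟩ := (Set.one_lt_ncard_iff_nontrivial).1 hn1
    have hsub : ∀ {a b : V}, a ∈ X ∩ H → b ∈ X ∩ H → a = b := (Set.ncard_le_one_iff (Set.toFinite _)).1 h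
    have key : ∀ p ∈ X, ∀ q ∈ X, p ≠ q → p ∈ H → ∃ x ∈ H, T.mem_Vx H x u := by
      intro p hp' q hq hpq hpH
      have hqu : q = u := by
        rcases hXs hq with h' | h'
        · exact h'
        · exact absurd (hsub ⟨hp', hpH⟩ ⟨hq, h'⟩) hpq
      have hXe : X = {u, p} := by
        ext z
        constructor
        · intro hz
          rcases hXs hz with h' | h'
          · exact Or.inl h'
          · exact Or.inr (hsub ⟨hz, h'⟩ ⟨hp', hpH⟩)
        · rintro (h' | h')
          · rw [h', ← hqu]; exact hq
          · rw [h']; exact hp'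
      exact ⟨p, hpH, hu, hXe ▸ ⟨hXs, hX⟩⟩
    rcases hXs ha with h' | h'
    · rcases hXs hb with h'' | h''
      · exact absurd (h'.trans h''.symm) hab
      · exact key b hb a ha hab.symm h''
    · exact key a ha b hb hab h'
  · left
    have hHX : H ⊆ X := Set.inter_eq_right.1 h
    have huX : u ∉ X := by
      intro h'
      exact hn2 (Set.Subset.antisymm hXs (Set.insert_subset h' hHX))
    rcases hX u ⟨Or.inl rfl, huX⟩ with h' | h'
    · exact Or.inl fun x hx => h' x (hHX hx)
    · exact Or.inr fun x hx => h' x (hHX hx)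

theorem aux_pair {V : Type} [Fintype V] (T : Tournament V) (S : Set V) (a b : V)
    (hab : a ≠ b) (hp : T.PrimeOn S) (h3 : 3 ≤ S.ncard) (h : T.HomogOn S {a, b}) : False := by
  have h2 := Set.ncard_pair hab
  rcases hp.2 _ h with h' | h'
  · omega
  · rw [← h'] at h3; omega

theorem aux_compl {V : Type} [Fintype V] (T : Tournament V) (S : Set V) (a : V)
    (ha : a ∈ S) (hp : T.PrimeOn S) (h3 : 3 ≤ S.ncard)
    (h : (∀ x ∈ S \ {a}, T.rel a x) ∨ (∀ x ∈ S \ {a}, T.rel x a)) : False := by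
  have h2 := Set.ncard_sdiff_singleton_of_mem ha
  have hh : T.HomogOn S (S \ {a}) := by
    refine ⟨Set.sdiff_subset, fun v hv => ?_⟩
    have : v = a := by
      by_contra hne
      exact hv.2 ⟨hv.1, hne⟩
    rw [this]; exact h
  rcases hp.2 _ hh with h' | h'
  · omega
  · rw [h'] at h2; omega

theorem aux_mixed {V : Type} [Fintype V] (T : Tournament V) (u : V) (H C : Set V)
    (hCH : C ⊆ H) (hp : T.PrimeOn C) (h3 : 3 ≤ C.ncard)
    (hz : (∀ x ∈ C, T.rel u x) ∨ (∀ x ∈ C, T.rel x u)) (y : V) (hy : y ∈ C)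
    (hv : T.mem_Vx H y u) : False := by
  obtain ⟨hu, -, hv⟩ := hv
  refine aux_compl T C y hy hp h3 ?_
  have hne : ∀ x ∈ C, x ≠ u := fun x hx h => hu (h ▸ hCH hx)
  have hm : ∀ x ∈ C \ {y}, (T.rel x u ∧ T.rel x y) ∨ (T.rel u x ∧ T.rel y x) := by
    intro x hx
    have hx2 : x ∉ ({u, y} : Set V) := by
      rintro (h | h)
      · exact hne x hx.1 h
      · exact hx.2 h
    rcases hv x ⟨Or.inr (hCH hx.1), hx2⟩ with h | h
    · exact Or.inl ⟨h u (by simp), h y (by simp)⟩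
    · exact Or.inr ⟨h u (by simp), h y (by simp)⟩
  rcases hz with hz | hz
  · left; intro x hx
    rcases hm x hx with h | h
    · exact absurd h.1 (T.asymm _ _ (hz x hx.1))
    · exact h.2
  · right; intro x hx
    rcases hm x hx with h | h
    · exact h.2
    · exact absurd h.1 (T.asymm _ _ (hz x hx.1))

theorem aux_twin {V : Type} (T : Tournament V) (u : V) (H : Set V) (y : V)
    (hv : T.mem_Vx H y u) : ∀ x ∈ H, x ≠ y →
      (T.rel x u ∧ T.rel x y) ∨ (T.rel u x ∧ T.rel y x) := by
  intro x hx hxy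
  obtain ⟨hu, -, hv⟩ := hv
  have hx2 : x ∉ ({u, y} : Set V) := by
    rintro (h | h)
    · exact hu (h ▸ hx)
    · exact hxy h
  rcases hv x ⟨Or.inr hx, hx2⟩ with h | h
  · exact Or.inl ⟨h u (by simp), h y (by simp)⟩
  · exact Or.inr ⟨h u (by simp), h y (by simp)⟩

/-- If `H₁, H₂` are prime subtournaments of a prime tournament `G` with
`V(H₁) ∪ V(H₂) = V(G) ∖ {u}`, both `H₁ + u` and `H₂ + u` decomposable, and the
subtournament induced on `V(H₁) ∩ V(H₂)` prime with at least 3 vertices, then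
`u ∈ V_x(H₁)` for some `x ∈ V(H₁) ∖ V(H₂)` or `u ∈ V_y(H₂)` for some
`y ∈ V(H₂) ∖ V(H₁)`. -/
theorem stmt3 {V : Type} [Fintype V] (T : Tournament V)
    (hG : T.PrimeOn Set.univ) (u : V) (H1 H2 : Set V)
    (h1 : T.PrimeOn H1) (h2 : T.PrimeOn H2)
    (hcover : H1 ∪ H2 = Set.univ \ {u})
    (hd1 : ¬ T.PrimeOn (insert u H1)) (hd2 : ¬ T.PrimeOn (insert u H2))
    (h12 : T.PrimeOn (H1 ∩ H2)) (hc : 3 ≤ (H1 ∩ H2).ncard) :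
    (∃ x ∈ H1 \ H2, T.mem_Vx H1 x u) ∨ (∃ y ∈ H2 \ H1, T.mem_Vx H2 y u) := by
  have hu : u ∉ H1 ∪ H2 := by rw [hcover]; simp
  have hu1 : u ∉ H1 := fun h => hu (Or.inl h)
  have hu2 : u ∉ H2 := fun h => hu (Or.inr h)
  have hcov : ∀ v, v ≠ u → v ∈ H1 ∨ v ∈ H2 := by
    intro v hv
    have : v ∈ H1 ∪ H2 := by rw [hcover]; exact ⟨trivial, hv⟩
    exact this
  have hU : 3 ≤ (Set.univ : Set V).ncard :=
    hc.trans (Set.ncard_le_ncard (Set.subset_univ _))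
  by_contra hcon
  push Not at hcon
  obtain ⟨hc1, hc2⟩ := hcon
  rcases aux_decomp T u H1 hu1 h1 hd1 with hz1 | ⟨x, hx, hxv⟩
  · rcases aux_decomp T u H2 hu2 h2 hd2 with hz2 | ⟨y, hy, hyv⟩
    · obtain ⟨c, hcc⟩ := h12.1
      refine aux_compl T Set.univ u trivial hG hU ?_
      rcases hz1 with hz1 | hz1 <;> rcases hz2 with hz2 | hz2
      · exact Or.inl fun v hv => (hcov v hv.2).elim (hz1 v) (hz2 v)
      · exact absurd (hz2 c hcc.2) (T.asymm _ _ (hz1 c hcc.1))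
      · exact absurd (hz2 c hcc.2) (T.asymm _ _ (hz1 c hcc.1))
      · exact Or.inr fun v hv => (hcov v hv.2).elim (hz1 v) (hz2 v)
    · have hy1 : y ∈ H1 := by
        by_contra h
        exact hc2 y ⟨hy, h⟩ hyv
      exact aux_mixed T u H2 (H1 ∩ H2) Set.inter_subset_right h12 hc
        (hz1.imp (fun h x hx => h x hx.1) (fun h x hx => h x hx.1)) y ⟨hy1, hy⟩ hyv
  · have hx2 : x ∈ H2 := by
      by_contra h
      exact hc1 x ⟨hx, h⟩ hxv
    rcases aux_decomp T u H2 hu2 h2 hd2 with hz2 | ⟨y, hy, hyv⟩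
    · exact aux_mixed T u H1 (H1 ∩ H2) Set.inter_subset_left h12 hc
        (hz2.imp (fun h x hx => h x hx.2) (fun h x hx => h x hx.2)) x ⟨hx, hx2⟩ hxv
    · have hy1 : y ∈ H1 := by
        by_contra h
        exact hc2 y ⟨hy, h⟩ hyv
      have t1 := aux_twin T u H1 x hxv
      have t2 := aux_twin T u H2 y hyv
      by_cases hxy : x = y
      · subst hxy
        refine aux_pair T Set.univ u x (fun h => hu1 (h ▸ hx)) hG hU
          ⟨Set.subset_univ _, fun v hv => ?_⟩
        have hvu : v ≠ u := fun h => hv.2 (Or.inl h)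
        have hvx : v ≠ x := fun h => hv.2 (Or.inr h)
        have : (T.rel v u ∧ T.rel v x) ∨ (T.rel u v ∧ T.rel x v) :=
          (hcov v hvu).elim (fun h => t1 v h hvx) (fun h => t2 v h hvx)
        simpa using this
      · refine aux_pair T (H1 ∩ H2) x y hxy h12 hc ⟨?_, fun v hv => ?_⟩
        · rintro z (h | h)
          · rw [h]; exact ⟨hx, hx2⟩
          · rw [h]; exact ⟨hy1, hy⟩
        · have hvx : v ≠ x := fun h => hv.2 (Or.inl h)
          have hvy : v ≠ y := fun h => hv.2 (Or.inr h)
          have a1 := t1 v hv.1.1 hvx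
          have a2 := t2 v hv.1.2 hvy
          have a3 := T.asymm v u
          have : (T.rel v x ∧ T.rel v y) ∨ (T.rel x v ∧ T.rel y v) := by tauto
          simpa using this
end
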